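/- arXiv:1809.01514 — 2 statements merged into one kernel-verified Lean document; each statement's English description precedes it below -/
import Mathlib

section
/- For every positive integer d, the Aguiar coefficient a_{(2d),(d)}^{(d,d)} (i.e. for ν the two-row partition with both parts equal to d) equals 1. -/
open scoped BigOperators
open scoped Classical

/-- A partition: a finitely supported antitone sequence of natural numbers
(the parts, indexed from 0). -/
def IsPartitionFun (f : ℕ →₀ ℕ) : Prop := ∀ ⦃i j : ℕ⦄, i ≤ j → f j ≤ f i

def Partition' : Type := {f : ℕ →₀ ℕ // IsPartitionFun f}

namespace Partition'

/-- The size `|λ|` of a partition. -/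
def size (l : Partition') : ℕ := l.1.sum fun _ v => v

/-- The number of (nonzero) parts of a partition. -/
def plength (l : Partition') : ℕ := l.1.support.card

noncomputable instance : Add Partition' :=
  ⟨fun l m => ⟨l.1 + m.1, fun i j h => by
    simp only [Finsupp.add_apply]
    exact add_le_add (l.2 h) (m.2 h)⟩⟩

noncomputable instance : SMul ℕ Partition' :=
  ⟨fun d l => ⟨d • l.1, fun i j h => by
    simp only [Finsupp.smul_apply, smul_eq_mul]
    exact Nat.mul_le_mul_left d (l.2 h)⟩⟩

/-- The one-row partition `(m)`. For `m = 0` this is the empty partition. -/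
noncomputable def row (m : ℕ) : Partition' :=
  ⟨Finsupp.single 0 m, by
    intro i j h
    simp only [Finsupp.single_apply]
    split_ifs <;> omega⟩

/-- The two-row partition `(a, b)` (with `b ≤ a`). -/
noncomputable def twoRow (a b : ℕ) (hba : b ≤ a) : Partition' :=
  ⟨Finsupp.single 0 a + Finsupp.single 1 b, by
    intro i j h
    simp only [Finsupp.add_apply, Finsupp.single_apply]
    split_ifs <;> omega⟩

/-- `youngCount n a g` is the number of fixed points of the permutation `g` acting on the
set of functions `Fin n → Fin n` whose fibre over `i` has exactly `a i` elements; i.e. the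
value at `g` of the permutation character of `S_n` acting on cosets of the Young subgroup
attached to the composition `a`. It is `0` if some `a i` is negative. -/
noncomputable def youngCount (n : ℕ) (a : Fin n → ℤ) (g : Equiv.Perm (Fin n)) : ℤ :=
  if ∀ i, 0 ≤ a i then
    (Nat.card {f : Fin n → Fin n //
      f ∘ g = f ∧ ∀ i : Fin n, Nat.card {x : Fin n // f x = i} = (a i).toNat} : ℤ)
  else 0

/-- The irreducible character of the symmetric group `S_n` attached to a partition `l`
of `n`, given by the Jacobi–Trudi determinantal formula
`χ_l = det (h_{l_i - i + j})` expanded over permutations, where `h`-products are the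
permutation characters of Young subgroups. (When `size l ≠ n` this is not used.) -/
noncomputable def irrChar (n : ℕ) (l : Partition') (g : Equiv.Perm (Fin n)) : ℤ :=
  ∑ σ : Equiv.Perm (Fin n), (Equiv.Perm.sign σ : ℤ) *
    youngCount n (fun i => (l.1 i : ℤ) + ((σ i : ℕ) : ℤ) - (i : ℤ)) g

/-- The Kronecker coefficient `g_{λ,μ,ν}`: the multiplicity of the irreducible `S_n`-module
`M_ν` in `M_λ ⊗ M_μ` (for `|λ| = |μ| = |ν| = n`), computed as the scalar product of
characters `(1/n!) ∑_{g ∈ S_n} χ_λ(g) χ_μ(g) χ_ν(g)`; it is `0` if the sizes differ. -/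
noncomputable def kron (l m nu : Partition') : ℕ :=
  if size l = size nu ∧ size m = size nu then
    ((∑ g : Equiv.Perm (Fin (size nu)),
        irrChar (size nu) l g * irrChar (size nu) m g * irrChar (size nu) nu g) /
      (Nat.factorial (size nu) : ℤ)).toNat
  else 0

/-- The standard embedding `S_a × S_b ↪ S_{a+b}`. -/
def sumEmb {a b : ℕ} (g : Equiv.Perm (Fin a)) (h : Equiv.Perm (Fin b)) :
    Equiv.Perm (Fin (a + b)) :=
  (Equiv.permCongr finSumFinEquiv) (Equiv.sumCongr g h)

/-- The Littlewood–Richardson coefficient `c_{λ,μ}^ν`: the multiplicity of `M_ν` in the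
induction of `M_λ ⊠ M_μ` from `S_{|λ|} × S_{|μ|}` to `S_{|λ|+|μ|}`, computed by
Frobenius reciprocity as a scalar product of characters; it is `0` unless
`|ν| = |λ| + |μ|`. -/
noncomputable def lr (l m nu : Partition') : ℕ :=
  if size nu = size l + size m then
    ((∑ g : Equiv.Perm (Fin (size l)), ∑ h : Equiv.Perm (Fin (size m)),
        irrChar (size l) l g * irrChar (size m) m h *
          irrChar (size l + size m) nu (sumEmb g h)) /
      ((Nat.factorial (size l) : ℤ) * (Nat.factorial (size m) : ℤ))).toNat
  else 0

/-- The Aguiar coefficient `a_{λ,μ}^ν`, defined by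
`a_{λ,μ}^ν = Σ_{α,β,δ,η,ρ,τ} c_{α,β}^λ c_{η,ρ}^μ g_{β,η,δ} c_{α,δ}^τ c_{τ,ρ}^ν`. -/
noncomputable def aguiar (l m nu : Partition') : ℕ :=
  ∑ᶠ (α : Partition') (β : Partition') (δ : Partition') (η : Partition')
    (ρ : Partition') (τ : Partition'),
    lr α β l * lr η ρ m * kron β η δ * lr α δ τ * lr τ ρ nu

end Partition'


namespace AguiarAux
open Partition' Polynomial

lemma sum_cnt {n : ℕ} {K : Type} [Fintype K] (f : Fin n → K) :
    ∑ k, Nat.card {x : Fin n // f x = k} = n := by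
  have h := Nat.card_congr (Equiv.sigmaFiberEquiv f)
  rw [Nat.card_sigma] at h
  simpa using h

lemma exists_cnt {n : ℕ} {K : Type} [Fintype K] (u : K → ℕ) (hu : ∑ k, u k = n) :
    ∃ f : Fin n → K, ∀ k, Nat.card {x : Fin n // f x = k} = u k := by
  have e : Fin n ≃ (Σ k, Fin (u k)) := Fintype.equivOfCardEq (by simp [hu])
  refine ⟨fun x => (e x).1, fun k => ?_⟩
  have e2 : {x : Fin n // (e x).1 = k} ≃ {y : (Σ k, Fin (u k)) // y.1 = k} :=
    e.subtypeEquiv (fun _ => Iff.rfl)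
  rw [Nat.card_congr (e2.trans (Equiv.sigmaSubtype k))]
  simp

lemma exists_perm {n : ℕ} {K : Type} (f f' : Fin n → K)
    (h : ∀ k, Nat.card {x : Fin n // f x = k} = Nat.card {x : Fin n // f' x = k}) :
    ∃ p : Equiv.Perm (Fin n), f' ∘ p = f := by
  have e : ∀ k, {x : Fin n // f x = k} ≃ {x : Fin n // f' x = k} := fun k =>
    Fintype.equivOfCardEq (by rw [← Nat.card_eq_fintype_card, ← Nat.card_eq_fintype_card, h k])
  exact ⟨Equiv.ofFiberEquiv e, funext fun x => Equiv.ofFiberEquiv_map e x⟩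

lemma basic {n : ℕ} {K : Type} [Fintype K] (u : K → ℕ) :
    ∑ g : Equiv.Perm (Fin n), Nat.card {f : Fin n → K //
      f ∘ g = f ∧ ∀ k, Nat.card {x : Fin n // f x = k} = u k}
      = if ∑ k, u k = n then n.factorial else 0 := by
  split_ifs with hu
  · obtain ⟨f0, hf0⟩ := exists_cnt u hu
    have hp : ∀ f : Fin n → K, (∀ k, Nat.card {x : Fin n // f x = k} = u k) →
        ∃ p : Equiv.Perm (Fin n), f0 ∘ p = f := fun f hf =>
      exists_perm f f0 (fun k => by rw [hf, hf0])
    choose! p hp using hp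
    have hq : ∀ q : Equiv.Perm (Fin n), ∀ k, Nat.card {x : Fin n // (f0 ∘ q) x = k} = u k := by
      intro q k
      rw [← hf0 k]
      exact Nat.card_congr (q.subtypeEquiv (fun _ => Iff.rfl))
    have E : (Σ g : Equiv.Perm (Fin n), {f : Fin n → K //
        f ∘ g = f ∧ ∀ k, Nat.card {x : Fin n // f x = k} = u k}) ≃ Equiv.Perm (Fin n) :=
      { toFun := fun z => p z.2.1 * z.1
        invFun := fun q => ⟨(p (f0 ∘ q))⁻¹ * q, ⟨f0 ∘ q, by
          have h1 := hp (f0 ∘ q) (hq q)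
          refine ⟨?_, hq q⟩
          funext x
          have h2 := congrFun h1 ((p (f0 ∘ q))⁻¹ (q x))
          simp only [Function.comp_apply, ← Equiv.Perm.mul_apply] at h2
          simpa using h2.symm⟩⟩
        left_inv := by
          rintro ⟨g, f, hf1, hf2⟩
          have h1 : f0 ∘ ⇑(p f * g) = f := by
            rw [Equiv.Perm.coe_mul, ← Function.comp_assoc, hp f hf2, hf1]
          have h2 : (p (f0 ∘ ⇑(p f * g)))⁻¹ * (p f * g) = g := by
            rw [h1]; group
          refine Sigma.ext h2 ?_
          dsimp only
          have gen : ∀ (g1 g2 : Equiv.Perm (Fin n)) (f1 f2 : Fin n → K) (h1) (h2), g1 = g2 → f1 = f2 →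
            HEq (⟨f1, h1⟩ : {f : Fin n → K // f ∘ g1 = f ∧
              ∀ k, Nat.card {x : Fin n // f x = k} = u k})
              (⟨f2, h2⟩ : {f : Fin n → K // f ∘ g2 = f ∧
              ∀ k, Nat.card {x : Fin n // f x = k} = u k}) := by
            rintro g1 g2 f1 f2 h1 h2 rfl rfl
            rfl
          exact gen _ _ _ _ _ _ h2 h1
        right_inv := fun q => by simp }
    have h := Nat.card_congr E
    rw [Nat.card_sigma] at h
    rw [h]
    simp [Fintype.card_perm]
  · refine Finset.sum_eq_zero fun g _ => ?_
    rw [Nat.card_eq_zero]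
    left
    refine ⟨fun z => hu ?_⟩
    rw [← sum_cnt z.1]
    exact Finset.sum_congr rfl fun k _ => (z.2.2 k).symm

noncomputable def hh (m : ℤ) : ℤ[X] :=
  if 0 ≤ m then ∑ k ∈ Finset.range (m.toNat + 1), X ^ k else 0

lemma W_eq {n : ℕ} (c : Fin n → ℕ) (a : ℕ) :
    (∏ i, hh (c i)).coeff a =
      (((Fintype.piFinset fun i => Finset.range (c i + 1)).filter
        (fun w => ∑ i, w i = a)).card : ℤ) := by
  have : ∏ i, hh (c i) = ∏ i, ∑ k ∈ Finset.range (c i + 1), (X : ℤ[X]) ^ k := by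
    refine Finset.prod_congr rfl fun i _ => ?_
    simp [hh]
  rw [this, Finset.prod_univ_sum, finsetSum_coeff, Finset.card_filter]
  push_cast
  refine Finset.sum_congr rfl fun w _ => ?_
  rw [Finset.prod_pow_eq_pow_sum, coeff_X_pow]
  simp [eq_comm]

lemma W_neg {n : ℕ} (c : Fin n → ℤ) (a : ℕ) (h : ¬ ∀ i, 0 ≤ c i) :
    (∏ i, hh (c i)).coeff a = 0 := by
  push Not at h
  obtain ⟨i, hi⟩ := h
  rw [Finset.prod_eq_zero (Finset.mem_univ i)]
  · simp
  · simp [hh, hi]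

lemma L2 {n : ℕ} (c : Fin n → ℤ) (hc : ∑ i, c i = n) :
    ∑ g, youngCount n c g = if ∀ i, 0 ≤ c i then (n.factorial : ℤ) else 0 := by
  unfold youngCount
  split_ifs with h
  · have := basic (n := n) (fun i => (c i).toNat)
    rw [if_pos] at this
    · rw [← this]; push_cast; rfl
    · zify
      rw [← hc]
      exact Finset.sum_congr rfl fun i _ => by simp [h i]
  · simp

end AguiarAux

namespace AguiarAux
open Partition' Polynomial

/-- splitting functions on `Fin (a+b)` -/
def splitE (a b : ℕ) (K : Type) : (Fin (a + b) → K) ≃ (Fin a → K) × (Fin b → K) :=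
  (Equiv.arrowCongr finSumFinEquiv.symm (Equiv.refl K)).trans (Equiv.sumArrowEquivProdArrow _ _ _)

lemma splitE_fst {a b : ℕ} {K : Type} (f : Fin (a + b) → K) (x : Fin a) :
    (splitE a b K f).1 x = f (Fin.castAdd b x) := rfl

lemma splitE_snd {a b : ℕ} {K : Type} (f : Fin (a + b) → K) (x : Fin b) :
    (splitE a b K f).2 x = f (Fin.natAdd a x) := rfl

lemma sumEmb_castAdd {a b : ℕ} (g : Equiv.Perm (Fin a)) (h : Equiv.Perm (Fin b)) (x : Fin a) :
    sumEmb g h (Fin.castAdd b x) = Fin.castAdd b (g x) := by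
  simp [sumEmb, Equiv.permCongr_apply]

lemma sumEmb_natAdd {a b : ℕ} (g : Equiv.Perm (Fin a)) (h : Equiv.Perm (Fin b)) (x : Fin b) :
    sumEmb g h (Fin.natAdd a x) = Fin.natAdd a (h x) := by
  simp [sumEmb, Equiv.permCongr_apply]

lemma cnt_split {a b : ℕ} {K : Type} (f : Fin (a + b) → K) (k : K) :
    Nat.card {x // f x = k} = Nat.card {x // (splitE a b K f).1 x = k}
      + Nat.card {x // (splitE a b K f).2 x = k} := by
  rw [← Nat.card_sum]
  have e1 : {x // f x = k} ≃ {y : Fin a ⊕ Fin b // f (finSumFinEquiv y) = k} :=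
    finSumFinEquiv.symm.subtypeEquiv (fun x => by simp)
  exact Nat.card_congr (e1.trans Equiv.subtypeSum)

lemma fix_split {a b : ℕ} {K : Type} (f : Fin (a + b) → K) (g : Equiv.Perm (Fin a))
    (h : Equiv.Perm (Fin b)) :
    f ∘ sumEmb g h = f ↔ (splitE a b K f).1 ∘ g = (splitE a b K f).1 ∧
      (splitE a b K f).2 ∘ h = (splitE a b K f).2 := by
  simp only [funext_iff, Function.comp_apply, splitE_fst, splitE_snd]
  constructor
  · intro H
    refine ⟨fun x => ?_, fun x => ?_⟩
    · rw [← sumEmb_castAdd g h, H]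
    · rw [← sumEmb_natAdd g h, H]
  · rintro ⟨H1, H2⟩ x
    induction x using Fin.addCases with
    | left x => rw [sumEmb_castAdd, H1]
    | right x => rw [sumEmb_natAdd, H2]

lemma L3a {a b : ℕ} {K : Type} [Fintype K] [DecidableEq K] (c : K → ℕ) (g : Equiv.Perm (Fin a))
    (h : Equiv.Perm (Fin b)) :
    Nat.card {f : Fin (a + b) → K // f ∘ sumEmb g h = f ∧ ∀ k, Nat.card {x // f x = k} = c k}
    = ∑ w ∈ Fintype.piFinset fun i => Finset.range (c i + 1),
      Nat.card {f : Fin a → K // f ∘ g = f ∧ ∀ k, Nat.card {x // f x = k} = w k} *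
      Nat.card {f : Fin b → K // f ∘ h = f ∧ ∀ k, Nat.card {x // f x = k} = c k - w k} := by
  have e : {f : Fin (a + b) → K // f ∘ sumEmb g h = f ∧ ∀ k, Nat.card {x // f x = k} = c k} ≃
      {p : (Fin a → K) × (Fin b → K) // (p.1 ∘ g = p.1 ∧ p.2 ∘ h = p.2) ∧
        ∀ k, Nat.card {x // p.1 x = k} + Nat.card {x // p.2 x = k} = c k} :=
    (splitE a b K).subtypeEquiv (fun f => by
      rw [fix_split]
      simp only [cnt_split])
  rw [Nat.card_congr e, Nat.card_eq_fintype_card, Fintype.card_subtype,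
    Finset.card_eq_sum_card_fiberwise (f := fun p k => Nat.card {x // p.1 x = k})
      (t := Fintype.piFinset fun i => Finset.range (c i + 1))]
  · refine Finset.sum_congr rfl fun w hw => ?_
    rw [Nat.card_eq_fintype_card, Nat.card_eq_fintype_card, Fintype.card_subtype,
      Fintype.card_subtype, ← Finset.card_product]
    congr 1
    ext ⟨p, q⟩
    simp only [Finset.mem_filter, Finset.mem_univ, true_and, Finset.mem_product, funext_iff]
    simp only [Fintype.mem_piFinset, Finset.mem_range] at hw
    constructor
    · rintro ⟨⟨⟨h1, h2⟩, h3⟩, h4⟩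
      refine ⟨⟨h1, h4⟩, h2, fun k => ?_⟩
      have := h3 k
      have := h4 k
      omega
    · rintro ⟨⟨h1, h4⟩, h2, h3⟩
      refine ⟨⟨⟨h1, h2⟩, fun k => ?_⟩, h4⟩
      have := h3 k
      have := h4 k
      have := hw k
      omega
  · intro p hp
    simp only [Finset.coe_filter, Finset.mem_univ, true_and, Set.mem_ofPred_eq] at hp
    simp only [Finset.mem_coe, Fintype.mem_piFinset, Finset.mem_range]
    intro k
    have := hp.2 k
    omega

lemma L3 {a b : ℕ} (c : Fin (a + b) → ℤ) (hc : ∑ i, c i = (a + b : ℕ)) :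
    ∑ g : Equiv.Perm (Fin a), ∑ h : Equiv.Perm (Fin b), youngCount (a + b) c (sumEmb g h) =
      (a.factorial : ℤ) * b.factorial * (∏ i, hh (c i)).coeff a := by
  by_cases h0 : ∀ i, 0 ≤ c i
  · lift c to Fin (a + b) → ℕ using h0
    have hc' : ∑ i, c i = a + b := by
      simp only at hc
      exact_mod_cast hc
    simp only [youngCount, Int.natCast_nonneg, implies_true, if_true, Int.toNat_natCast]
    rw [W_eq]
    norm_cast
    simp_rw [L3a]
    calc _ = ∑ w ∈ Fintype.piFinset fun i => Finset.range (c i + 1),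
          (∑ g : Equiv.Perm (Fin a), Nat.card {f : Fin a → Fin (a + b) //
            f ∘ g = f ∧ ∀ k, Nat.card {x // f x = k} = w k}) *
          (∑ h : Equiv.Perm (Fin b), Nat.card {f : Fin b → Fin (a + b) //
            f ∘ h = f ∧ ∀ k, Nat.card {x // f x = k} = c k - w k}) := by
          simp_rw [Finset.sum_mul_sum]
          rw [Finset.sum_comm]
          conv_lhs =>
            enter [2, h]
            rw [Finset.sum_comm]
          rw [Finset.sum_comm]
          exact Finset.sum_congr rfl fun w _ => Finset.sum_comm
      _ = ∑ w ∈ Fintype.piFinset fun i => Finset.range (c i + 1),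
          if ∑ i, w i = a then a.factorial * b.factorial else 0 := by
          refine Finset.sum_congr rfl fun w hw => ?_
          simp only [Fintype.mem_piFinset, Finset.mem_range] at hw
          rw [basic, basic (fun k => c k - w k)]
          have h1 : ∑ i, (c i - w i) + ∑ i, w i = a + b := by
            rw [← Finset.sum_add_distrib]
            refine Eq.trans ?_ hc'
            exact Finset.sum_congr rfl fun i _ => by have := hw i; omega
          split_ifs <;> omega
      _ = _ := by
          rw [← Finset.sum_filter, Finset.sum_const, smul_eq_mul, mul_comm]
  · rw [W_neg _ _ h0]
    simp [youngCount, h0]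

lemma L4a {n : ℕ} {K : Type} [Fintype K] [DecidableEq K] (c : K → ℕ) (a : ℕ) (g : Equiv.Perm (Fin n)) :
    Nat.card {f : Fin n → K // f ∘ g = f ∧ ∀ k, Nat.card {x // f x = k} = c k} *
    Nat.card {s : Fin n → Bool // s ∘ g = s ∧ Nat.card {x // s x = true} = a} =
    ∑ w ∈ (Fintype.piFinset fun i => Finset.range (c i + 1)).filter (fun w => ∑ i, w i = a),
      Nat.card {f : Fin n → K × Bool // f ∘ g = f ∧ ∀ k, Nat.card {x // f x = k} =
        if k.2 = true then w k.1 else c k.1 - w k.1} := by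
  have hb : ∀ (F : Fin n → K × Bool) (k : K), Nat.card {x // (F x).1 = k} =
      Nat.card {x // F x = (k, true)} + Nat.card {x // F x = (k, false)} := by
    intro F k
    simp only [Nat.card_eq_fintype_card, Fintype.card_subtype]
    rw [← Finset.card_union_of_disjoint]
    · congr 1
      ext x
      simp only [Finset.mem_filter, Finset.mem_univ, true_and, Finset.mem_union, Prod.ext_iff]
      cases (F x).2 <;> simp
    · rw [Finset.disjoint_filter]
      intro x _ h1 h2
      rw [h1] at h2
      simp at h2
  have ht : ∀ (F : Fin n → K × Bool), Nat.card {x // (F x).2 = true} =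
      ∑ k, Nat.card {x // F x = (k, true)} := by
    intro F
    simp only [Nat.card_eq_fintype_card, Fintype.card_subtype]
    rw [Finset.card_eq_sum_card_fiberwise (f := fun x => (F x).1) (t := Finset.univ)
      (fun _ _ => by simp)]
    refine Finset.sum_congr rfl fun k _ => ?_
    rw [Finset.filter_filter]
    congr 1
    ext x
    simp [Prod.ext_iff, and_comm]
  have e : {F : Fin n → K × Bool // F ∘ g = F ∧ (∀ k, Nat.card {x // (F x).1 = k} = c k) ∧
      Nat.card {x // (F x).2 = true} = a} ≃
      {f : Fin n → K // f ∘ g = f ∧ ∀ k, Nat.card {x // f x = k} = c k} ×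
      {s : Fin n → Bool // s ∘ g = s ∧ Nat.card {x // s x = true} = a} :=
    { toFun := fun F => (⟨fun x => (F.1 x).1, by
          refine ⟨funext fun x => ?_, F.2.2.1⟩
          have := congrFun F.2.1 x
          simp only [Function.comp_apply] at this ⊢
          rw [this]⟩, ⟨fun x => (F.1 x).2, by
          refine ⟨funext fun x => ?_, F.2.2.2⟩
          have := congrFun F.2.1 x
          simp only [Function.comp_apply] at this ⊢
          rw [this]⟩)
      invFun := fun p => ⟨fun x => (p.1.1 x, p.2.1 x), by
          refine ⟨funext fun x => ?_, p.1.2.2, p.2.2.2⟩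
          have h1 := congrFun p.1.2.1 x
          have h2 := congrFun p.2.2.1 x
          simp only [Function.comp_apply] at h1 h2 ⊢
          rw [h1, h2]⟩
      left_inv := fun F => rfl
      right_inv := fun p => rfl }
  rw [← Nat.card_prod, ← Nat.card_congr e, Nat.card_eq_fintype_card, Fintype.card_subtype,
    Finset.card_eq_sum_card_fiberwise (f := fun F k => Nat.card {x // F x = (k, true)})
      (t := (Fintype.piFinset fun i => Finset.range (c i + 1)).filter (fun w => ∑ i, w i = a))]
  · refine Finset.sum_congr rfl fun w hw => ?_
    rw [Nat.card_eq_fintype_card, Fintype.card_subtype]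
    congr 1
    ext F
    simp only [Finset.mem_filter, Finset.mem_univ, true_and, funext_iff]
    simp only [Finset.mem_filter, Fintype.mem_piFinset, Finset.mem_range] at hw
    rw [ht]
    simp only [hb]
    constructor
    · rintro ⟨⟨h1, h2, h3⟩, h4⟩
      refine ⟨h1, ?_⟩
      rintro ⟨k, b⟩
      have := h2 k
      have := h4 k
      cases b
      · simp; simp at *; omega
      · simp; simp at *; omega
    · rintro ⟨h1, h2⟩
      have h3 : ∀ k, Nat.card {x // F x = (k, true)} = w k := fun k => by simpa using h2 (k, true)
      have h4 : ∀ k, Nat.card {x // F x = (k, false)} = c k - w k :=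
        fun k => by simpa using h2 (k, false)
      refine ⟨⟨h1, fun k => ?_, ?_⟩, h3⟩
      · rw [h3, h4]
        have := hw.1 k
        omega
      · simp only [h3]; exact hw.2
  · intro F hF
    simp only [Finset.coe_filter, Finset.mem_univ, true_and, Set.mem_ofPred_eq] at hF
    rw [ht] at hF
    simp only [hb] at hF
    simp only [Finset.coe_filter, Fintype.mem_piFinset, Finset.mem_range, Set.mem_ofPred_eq]
    refine ⟨fun k => ?_, hF.2.2⟩
    have := hF.2.1 k
    omega

lemma L4b {n a b : ℕ} (hab : a + b = n) (hn : 2 ≤ n) (g : Equiv.Perm (Fin n)) :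
    youngCount n (fun i => if (i : ℕ) = 0 then (a : ℤ) else if (i : ℕ) = 1 then (b : ℤ) else 0) g =
    Nat.card {s : Fin n → Bool // s ∘ g = s ∧ Nat.card {x // s x = true} = a} := by
  rw [youngCount, if_pos (by intro i; split_ifs <;> simp)]
  refine congrArg Nat.cast ?_
  let i0 : Fin n := ⟨0, by omega⟩
  let i1 : Fin n := ⟨1, by omega⟩
  have h01 : i1 ≠ i0 := by simp [i0, i1, Fin.ext_iff]
  have hf : ∀ f : Fin n → Fin n, (∀ i : Fin n, Nat.card {x // f x = i} =
      (if (i : ℕ) = 0 then (a : ℤ) else if (i : ℕ) = 1 then (b : ℤ) else 0).toNat) →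
      ∀ x, f x ≠ i0 → f x = i1 := by
    intro f hf x hx
    by_contra h1
    have := hf (f x)
    have e0 : (f x : ℕ) ≠ 0 := fun h => hx (Fin.ext h)
    have e1 : (f x : ℕ) ≠ 1 := fun h => h1 (Fin.ext h)
    rw [if_neg e0, if_neg e1, Int.toNat_zero, Nat.card_eq_zero] at this
    rcases this with h | h
    · exact h.false ⟨x, rfl⟩
    · exact h.not_finite inferInstance
  have htot : ∀ s : Fin n → Bool, Nat.card {x // s x = true} + Nat.card {x // s x = false} = n := by
    intro s
    have := sum_cnt s
    simpa using this
  refine Nat.card_congr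
    { toFun := fun f => ⟨fun x => decide (f.1 x = i0), ?_, ?_⟩
      invFun := fun s => ⟨fun x => if s.1 x = true then i0 else i1, ?_, ?_⟩
      left_inv := ?_
      right_inv := ?_ }
  · funext x
    have := congrFun f.2.1 x
    simp only [Function.comp_apply] at this ⊢
    rw [this]
  · have := f.2.2 i0
    simpa [i0] using this
  · funext x
    have := congrFun s.2.1 x
    simp only [Function.comp_apply] at this ⊢
    rw [this]
  · intro i
    have hs := s.2.2
    have hs2 := htot s.1
    by_cases h0 : i = i0
    · subst h0
      have : ∀ x, (if s.1 x = true then i0 else i1) = i0 ↔ s.1 x = true := by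
        intro x; split_ifs with h <;> simp [h, h01]
      simp only [this]
      rw [hs]
      simp [i0]
    by_cases h1 : i = i1
    · subst h1
      have : ∀ x, (if s.1 x = true then i0 else i1) = i1 ↔ s.1 x = false := by
        intro x; split_ifs with h <;> simp [h, h01.symm]
      simp only [this]
      have : Nat.card {x // s.1 x = false} = b := by omega
      rw [this]
      simp [i1]
    · have e0 : (i : ℕ) ≠ 0 := fun h => h0 (Fin.ext h)
      have e1 : (i : ℕ) ≠ 1 := fun h => h1 (Fin.ext h)
      rw [if_neg e0, if_neg e1, Int.toNat_zero, Nat.card_eq_zero]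
      left
      refine ⟨fun x => ?_⟩
      have := x.2
      beta_reduce at this
      split_ifs at this
      · exact h0 this.symm
      · exact h1 this.symm
  · intro f
    ext x : 2
    by_cases h : f.1 x = i0
    · simp [h]
    · simp only [h, decide_false, Bool.false_eq_true, if_false]
      exact (hf f.1 f.2.2 x h).symm
  · intro s
    ext x : 2
    cases h : s.1 x <;> simp [h, h01]

lemma L4 {n a b : ℕ} (hab : a + b = n) (hn : 2 ≤ n) (c : Fin n → ℤ) (hc : ∑ i, c i = n) :
    ∑ g, youngCount n c g * youngCount n
      (fun i => if (i : ℕ) = 0 then (a : ℤ) else if (i : ℕ) = 1 then (b : ℤ) else 0) g =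
      (n.factorial : ℤ) * (∏ i, hh (c i)).coeff a := by
  simp_rw [L4b hab hn]
  by_cases h0 : ∀ i, 0 ≤ c i
  · lift c to Fin n → ℕ using h0
    have hc' : ∑ i, c i = n := by
      simp only at hc
      exact_mod_cast hc
    simp only [youngCount, Int.natCast_nonneg, implies_true, if_true, Int.toNat_natCast]
    rw [W_eq]
    norm_cast
    simp_rw [L4a]
    rw [Finset.sum_comm]
    have : ∀ w ∈ (Fintype.piFinset fun i => Finset.range (c i + 1)).filter (fun w => ∑ i, w i = a),
        ∑ g : Equiv.Perm (Fin n), Nat.card {f : Fin n → Fin n × Bool // f ∘ g = f ∧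
          ∀ k, Nat.card {x // f x = k} = if k.2 = true then w k.1 else c k.1 - w k.1}
          = n.factorial := by
      intro w hw
      simp only [Finset.mem_filter, Fintype.mem_piFinset, Finset.mem_range] at hw
      rw [basic (fun k : Fin n × Bool => if k.2 = true then w k.1 else c k.1 - w k.1), if_pos]
      rw [Fintype.sum_prod_type]
      refine Eq.trans ?_ hc'
      refine Finset.sum_congr rfl fun i _ => ?_
      have := hw.1 i
      simp
      omega
    rw [Finset.sum_congr rfl this, Finset.sum_const, smul_eq_mul, mul_comm]
  · rw [W_neg _ _ h0]
    simp [youngCount, h0]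

end AguiarAux

namespace AguiarAux
open Partition' Polynomial

lemma zero_of_size {l : Partition'} {n i : ℕ} (h : size l = n) (hi : n ≤ i) : l.1 i = 0 := by
  by_contra h0
  have h1 : Finset.range (i + 1) ⊆ l.1.support := by
    intro j hj
    have := l.2 (show j ≤ i by simp at hj; omega)
    simp
    omega
  have h2 : l.1.support.card ≤ size l := by
    unfold size Finsupp.sum
    rw [Finset.card_eq_sum_ones]
    refine Finset.sum_le_sum fun j hj => ?_
    have : l.1 j ≠ 0 := by simpa using hj
    show 1 ≤ l.1 j
    omega
  have := Finset.card_le_card h1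
  simp at this
  omega

lemma size_sum {l : Partition'} {n : ℕ} (m : ℕ) (h : size l = n) (hm : n ≤ m) :
    ∑ i : Fin m, l.1 i = n := by
  rw [Fin.sum_univ_eq_sum_range (fun i => l.1 i) m]
  conv_rhs => rw [← h]
  unfold size Finsupp.sum
  symm
  refine Finset.sum_subset ?_ ?_
  · intro i hi
    simp only [Finset.mem_range]
    by_contra h2
    simp only [Finsupp.mem_support_iff] at hi
    exact hi (zero_of_size h (by omega))
  · intro i _ hi
    simpa using hi

lemma lc_sum {l : Partition'} {n : ℕ} (h : size l = n) (σ : Equiv.Perm (Fin n)) :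
    ∑ i : Fin n, ((l.1 i : ℤ) + ((σ i : ℕ) : ℤ) - (i : ℤ)) = n := by
  rw [Finset.sum_sub_distrib, Finset.sum_add_distrib,
    Equiv.sum_comp σ (fun i : Fin n => ((i : ℕ) : ℤ))]
  have := size_sum n h le_rfl
  zify at this
  linarith

lemma perm_one {n : ℕ} (σ : Equiv.Perm (Fin n)) (h : ∀ i : Fin n, (i : ℕ) ≤ σ i) : σ = 1 := by
  have h1 : ∑ i : Fin n, (i : ℕ) = ∑ i, (σ i : ℕ) :=
    (Equiv.sum_comp σ (fun i : Fin n => (i : ℕ))).symm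
  rw [Finset.sum_eq_sum_iff_of_le (fun i _ => h i)] at h1
  ext i
  simpa using (h1 i (Finset.mem_univ i)).symm

lemma perm_two {n : ℕ} (hn : 2 ≤ n) (σ : Equiv.Perm (Fin n))
    (h : ∀ i : Fin n, 2 ≤ (i : ℕ) → (i : ℕ) ≤ σ i) :
    σ = 1 ∨ σ = Equiv.swap ⟨0, by omega⟩ ⟨1, by omega⟩ := by
  set i0 : Fin n := ⟨0, by omega⟩ with hi0
  set i1 : Fin n := ⟨1, by omega⟩ with hi1
  have h01 : i0 ≠ i1 := by simp [i0, i1]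
  have hcase : ∀ i : Fin n, i = i0 ∨ i = i1 ∨ 2 ≤ (i : ℕ) := by
    intro i
    simp only [i0, i1, Fin.ext_iff]
    omega
  by_cases h1 : (σ i1 : ℕ) = 0
  · right
    have : σ * Equiv.swap i0 i1 = 1 := by
      apply perm_one
      intro i
      rcases hcase i with rfl | rfl | hi
      · simp [i0]
      · have : σ i0 ≠ σ i1 := fun h => h01 (σ.injective h)
        simp only [Equiv.Perm.mul_apply, Equiv.swap_apply_right]
        rw [Ne, Fin.ext_iff] at this
        simp only [i1] at *
        omega
      · rw [Equiv.Perm.mul_apply, Equiv.swap_apply_of_ne_of_ne]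
        · exact h i hi
        · simp only [i0, Ne, Fin.ext_iff]; omega
        · simp only [i1, Ne, Fin.ext_iff]; omega
    calc σ = (σ * Equiv.swap i0 i1) * Equiv.swap i0 i1 := by simp [mul_assoc]
      _ = _ := by rw [this, one_mul]
  · left
    apply perm_one
    intro i
    rcases hcase i with rfl | rfl | hi
    · simp [i0]
    · simp only [i1] at *; omega
    · exact h i hi

lemma sum_two {R : Type} [CommRing R] {n : ℕ} (hn : 2 ≤ n) (F : Equiv.Perm (Fin n) → R)
    (hF : ∀ σ, (∃ i : Fin n, 2 ≤ (i : ℕ) ∧ (σ i : ℕ) < i) → F σ = 0) :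
    ∑ σ, ((Equiv.Perm.sign σ : ℤ) : R) * F σ =
      F 1 - F (Equiv.swap ⟨0, by omega⟩ ⟨1, by omega⟩) := by
  set s : Equiv.Perm (Fin n) := Equiv.swap ⟨0, by omega⟩ ⟨1, by omega⟩ with hs
  have h1s : (1 : Equiv.Perm (Fin n)) ≠ s := by
    intro h
    have := congrArg (fun σ => Equiv.Perm.sign σ) h
    simp [hs] at this
  rw [← Finset.sum_subset (Finset.subset_univ {1, s}), Finset.sum_pair h1s]
  · have : Equiv.Perm.sign s = -1 := by
      rw [hs, Equiv.Perm.sign_swap]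
      simp [Fin.ext_iff]
    simp [this, sub_eq_add_neg]
  · intro σ _ hσ
    rw [hF, mul_zero]
    by_contra hcon
    push Not at hcon
    rcases perm_two hn σ hcon with h | h
    · simp [h] at hσ
    · simp [h, hs] at hσ

lemma size_row (m : ℕ) : size (row m) = m := by
  simp [size, row]

lemma size_twoRow (a b : ℕ) (h : b ≤ a) : size (twoRow a b h) = a + b := by
  unfold size twoRow
  dsimp only
  rw [Finsupp.sum_add_index'] <;> simp

lemma irr_row (n : ℕ) (g : Equiv.Perm (Fin n)) : irrChar n (row n) g = 1 := by
  unfold irrChar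
  rw [Finset.sum_eq_single 1]
  · simp only [Equiv.Perm.sign_one, Units.val_one, one_mul, Equiv.Perm.one_apply,
      add_sub_cancel_right, youngCount]
    rw [if_pos (by intro i; simp)]
    norm_cast
    rw [Nat.card_eq_one_iff_unique]
    rcases n with _ | n
    · refine ⟨⟨fun x y => Subtype.ext (Subsingleton.elim _ _)⟩, ⟨⟨fun i => i, ?_, ?_⟩⟩⟩
      · exact Subsingleton.elim _ _
      · intro i; exact i.elim0
    · constructor
      · have : ∀ f : Fin (n+1) → Fin (n+1), (∀ i : Fin (n+1), Nat.card {x // f x = i} =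
            (row (n+1)).1 i) → ∀ x, f x = 0 := by
          intro f hf x
          by_contra h1
          have := hf (f x)
          have e0 : 0 ≠ (f x : ℕ) := fun h => h1 (Fin.ext h.symm)
          simp only [row, Finsupp.single_apply, if_neg e0] at this
          rw [Nat.card_eq_zero] at this
          rcases this with h | h
          · exact h.false ⟨x, rfl⟩
          · exact h.not_finite inferInstance
        refine ⟨fun x y => Subtype.ext (funext fun z => ?_)⟩
        rw [this x.1 x.2.2, this y.1 y.2.2]
      · refine ⟨⟨fun _ => 0, rfl, ?_⟩⟩
        intro i
        by_cases h : i = 0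
        · subst h
          simp [row]
        · have e0 : 0 ≠ (i : ℕ) := fun h' => h (Fin.ext h'.symm)
          have e1 : (0 : Fin (n+1)) ≠ i := fun h' => h h'.symm
          simp [row, e0, e1]
  · intro σ _ hσ
    rw [youngCount, if_neg, mul_zero]
    intro h
    apply hσ
    apply perm_one
    intro i
    by_cases h0 : (i : ℕ) = 0
    · omega
    · have := h i
      have e0 : 0 ≠ (i : ℕ) := fun h' => h0 h'.symm
      simp only [row, Finsupp.single_apply, if_neg e0] at this
      push_cast at this
      omega
  · simp

lemma eq_row {l : Partition'} {n : ℕ} (h : size l = n) (h1 : l.1 1 = 0) : l = row n := by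
  have hz : ∀ i, 1 ≤ i → l.1 i = 0 := fun i hi => by have := l.2 hi; omega
  have hs := size_sum (n + 1) h (by omega)
  rw [Fin.sum_univ_succ] at hs
  simp only [Fin.val_succ, hz _ (Nat.le_add_left 1 _), Finset.sum_const_zero] at hs
  apply Subtype.ext
  ext i
  rcases i with _ | i
  · simpa [row] using hs
  · rw [hz _ (by omega)]; simp [row]

lemma sum_irr {l : Partition'} {n : ℕ} (h : size l = n) :
    ∑ g, irrChar n l g = if l = row n then (n.factorial : ℤ) else 0 := by
  split_ifs with hl
  · subst hl
    simp [irr_row, Fintype.card_perm]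
  · have h1 : 1 ≤ l.1 1 := by
      by_contra h1
      exact hl (eq_row h (by omega))
    have hn : 2 ≤ n := by
      by_contra h2
      have := zero_of_size h (show n ≤ 1 by omega)
      omega
    unfold irrChar
    rw [Finset.sum_comm]
    simp_rw [← Finset.mul_sum]
    have : ∀ σ : Equiv.Perm (Fin n), ∑ g, youngCount n
        (fun i => (l.1 i : ℤ) + ((σ i : ℕ) : ℤ) - (i : ℤ)) g =
        if ∀ i : Fin n, 0 ≤ (l.1 i : ℤ) + ((σ i : ℕ) : ℤ) - (i : ℤ)
          then (n.factorial : ℤ) else 0 := fun σ => L2 _ (lc_sum h σ)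
    simp_rw [this]
    set s : Equiv.Perm (Fin n) := Equiv.swap ⟨0, by omega⟩ ⟨1, by omega⟩ with hs
    have hsg : Equiv.Perm.sign s = -1 := by
      rw [hs, Equiv.Perm.sign_swap]
      simp [Fin.ext_iff]
    have key : ∀ σ : Equiv.Perm (Fin n),
        (∀ i : Fin n, 0 ≤ (l.1 i : ℤ) + (((σ * s) i : ℕ) : ℤ) - (i : ℤ)) ↔
        (∀ i : Fin n, 0 ≤ (l.1 i : ℤ) + ((σ i : ℕ) : ℤ) - (i : ℤ)) := by
      intro σ
      refine forall_congr' fun i => ?_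
      by_cases hi : 2 ≤ (i : ℕ)
      · rw [Equiv.Perm.mul_apply, hs, Equiv.swap_apply_of_ne_of_ne]
        · simp only [Ne, Fin.ext_iff]; omega
        · simp only [Ne, Fin.ext_iff]; omega
      · have := l.2 (show (i : ℕ) ≤ 1 by omega)
        constructor <;> intro _ <;> omega
    have hS := Equiv.sum_comp (Equiv.mulRight s) (fun σ : Equiv.Perm (Fin n) =>
      (Equiv.Perm.sign σ : ℤ) * if ∀ i : Fin n, 0 ≤ (l.1 i : ℤ) + ((σ i : ℕ) : ℤ) - (i : ℤ)
          then (n.factorial : ℤ) else 0)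
    simp only [Equiv.coe_mulRight, key, Equiv.Perm.sign_mul, hsg] at hS
    simp only [mul_neg, mul_one, Units.val_neg, neg_mul, Finset.sum_neg_distrib] at hS
    linarith

/-- two-variable (dehomogenised) Jacobi-Trudi determinant -/
noncomputable def D (n : ℕ) (l : Partition') : ℤ[X] :=
  ∑ σ : Equiv.Perm (Fin n), ((Equiv.Perm.sign σ : ℤ) : ℤ[X]) *
    ∏ i : Fin n, hh ((l.1 i : ℤ) + ((σ i : ℕ) : ℤ) - (i : ℤ))

lemma D_coeff (n : ℕ) (l : Partition') (a : ℕ) : (D n l).coeff a =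
    ∑ σ : Equiv.Perm (Fin n), (Equiv.Perm.sign σ : ℤ) *
    (∏ i : Fin n, hh ((l.1 i : ℤ) + ((σ i : ℕ) : ℤ) - (i : ℤ))).coeff a := by
  rw [D, finsetSum_coeff]
  refine Finset.sum_congr rfl fun σ _ => ?_
  rw [coeff_intCast_mul]
  simp

lemma hh_mul (m : ℕ) : hh ((m : ℤ) - 1) * (X - 1) = X ^ m - 1 := by
  rcases m with _ | m
  · simp [hh]
  · have : ((m + 1 : ℕ) : ℤ) - 1 = (m : ℤ) := by push_cast; ring
    rw [this, hh, if_pos (by omega), Int.toNat_natCast, geom_sum_mul]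

lemma Xne : (X - 1 : ℤ[X]) ≠ 0 := by
  simpa using X_sub_C_ne_zero (1 : ℤ)

lemma D_zero {n : ℕ} {l : Partition'} (h : size l = n) (h2 : l.1 2 ≠ 0) : D n l = 0 := by
  have hn : 3 ≤ n := by
    by_contra h3
    exact h2 (zero_of_size h (by omega))
  have h12 := l.2 (show 1 ≤ 2 by omega)
  have h01 := l.2 (show 0 ≤ 1 by omega)
  have hD : D n l = (Matrix.of fun j i : Fin n =>
      hh ((l.1 i : ℤ) + ((j : ℕ) : ℤ) - (i : ℤ))).det := by
    rw [Matrix.det_apply']; rfl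
  rw [hD, ← Matrix.exists_mulVec_eq_zero_iff]
  set e0 := l.1 0 + 1
  set e1 := l.1 1
  set e2 := l.1 2 - 1 with he2
  let i0 : Fin n := ⟨0, by omega⟩
  let i1 : Fin n := ⟨1, by omega⟩
  let i2 : Fin n := ⟨2, by omega⟩
  refine ⟨Pi.single i0 (X ^ e1 - X ^ e2) + Pi.single i1 (X ^ e2 - X ^ e0)
    + Pi.single i2 (X ^ e0 - X ^ e1), ?_, ?_⟩
  · intro hv
    have := congrFun hv i0
    simp [i0, i1, i2, sub_eq_zero] at this
    have := congrArg natDegree this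
    simp at this
    omega
  · funext j
    simp only [Matrix.mulVec_add, Matrix.mulVec_single, Pi.add_apply, Pi.smul_apply,
      Matrix.col_apply, Matrix.of_apply, Pi.zero_apply, MulOpposite.smul_eq_mul_unop,
      MulOpposite.unop_op]
    have k0 := hh_mul (e0 + j)
    have k1 := hh_mul (e1 + j)
    have k2 := hh_mul (e2 + j)
    have t0 : ((e0 + j : ℕ) : ℤ) - 1 = (l.1 i0 : ℤ) + ((j : ℕ) : ℤ) - ((i0 : ℕ) : ℤ) := by
      simp only [i0, e0]; push_cast; ring
    have t1 : ((e1 + j : ℕ) : ℤ) - 1 = (l.1 i1 : ℤ) + ((j : ℕ) : ℤ) - ((i1 : ℕ) : ℤ) := by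
      simp only [i1, e1]; push_cast; ring
    have t2 : ((e2 + j : ℕ) : ℤ) - 1 = (l.1 i2 : ℤ) + ((j : ℕ) : ℤ) - ((i2 : ℕ) : ℤ) := by
      simp only [i2]; omega
    rw [t0] at k0
    rw [t1] at k1
    rw [t2] at k2
    apply mul_right_cancel₀ Xne
    rw [zero_mul]
    linear_combination (X ^ e1 - X ^ e2) * k0 + (X ^ e2 - X ^ e0) * k1 + (X ^ e0 - X ^ e1) * k2

lemma D_two {n : ℕ} {l : Partition'} (hn : 2 ≤ n) (h2 : l.1 2 = 0) :
    D n l = ∑ k ∈ Finset.Ico (l.1 1) (l.1 0 + 1), X ^ k := by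
  have hz : ∀ i, 2 ≤ i → l.1 i = 0 := fun i hi => by have := l.2 hi; omega
  have h01 := l.2 (show 0 ≤ 1 by omega)
  have hD := sum_two hn (fun σ => ∏ i : Fin n, hh ((l.1 i : ℤ) + ((σ i : ℕ) : ℤ) - (i : ℤ))) (by
    rintro σ ⟨i, hi, hi2⟩
    refine Finset.prod_eq_zero (Finset.mem_univ i) ?_
    rw [hz i hi, hh, if_neg]
    push_cast
    omega)
  have hD' : D n l = _ := hD
  obtain ⟨m, rfl⟩ : ∃ m, n = m + 2 := ⟨n - 2, by omega⟩
  have hh0 : hh 0 = 1 := by simp [hh]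
  have hsw : ∀ i : Fin m, Equiv.swap (⟨0, by omega⟩ : Fin (m + 2)) ⟨1, by omega⟩ i.succ.succ
      = i.succ.succ := by
    intro i
    apply Equiv.swap_apply_of_ne_of_ne <;> simp [Fin.ext_iff]
  have s1 : Equiv.swap (⟨0, by omega⟩ : Fin (m + 2)) ⟨1, by omega⟩ 0 = 1 :=
    Equiv.swap_apply_left _ _
  have s2 : Equiv.swap (⟨0, by omega⟩ : Fin (m + 2)) ⟨1, by omega⟩ (Fin.succ 0) = 0 :=
    Equiv.swap_apply_right _ _
  simp only [Fin.prod_univ_succ, hsw, Equiv.Perm.one_apply, s1, s2, Fin.val_succ,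
    hz _ (Nat.le_add_left 2 _)] at hD'
  simp [hh0] at hD'
  rw [hD']
  apply mul_right_cancel₀ Xne
  rw [geom_sum_Ico_mul _ (by omega)]
  have k1 := hh_mul (l.1 0 + 1)
  have k2 := hh_mul (l.1 1 + 1)
  have k3 := hh_mul (l.1 0 + 2)
  have k4 := hh_mul (l.1 1)
  have a1 : ((l.1 0 + 1 : ℕ) : ℤ) - 1 = l.1 0 := by push_cast; ring
  have a2 : ((l.1 1 + 1 : ℕ) : ℤ) - 1 = l.1 1 := by push_cast; ring
  have a3 : ((l.1 0 + 2 : ℕ) : ℤ) - 1 = l.1 0 + 1 := by push_cast; ring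
  rw [a1] at k1
  rw [a2] at k2
  rw [a3] at k3
  apply mul_right_cancel₀ Xne
  have : ∀ A B C E : ℤ[X], (A * B - C * E) * (X - 1) * (X - 1) =
    (A * (X - 1)) * (B * (X - 1)) - (C * (X - 1)) * (E * (X - 1)) := fun A B C E => by ring
  rw [this, k1, k2, k3, k4]
  ring

end AguiarAux

namespace AguiarAux
open Partition' Polynomial

lemma lr_eq {l m nu : Partition'} {a b : ℕ} (ha : size l = a) (hb : size m = b)
    (h : size nu = a + b) :
    lr l m nu = ((∑ g : Equiv.Perm (Fin a), ∑ h : Equiv.Perm (Fin b),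
        irrChar a l g * irrChar b m h * irrChar (a + b) nu (sumEmb g h)) /
      ((Nat.factorial a : ℤ) * (Nat.factorial b : ℤ))).toNat := by
  subst ha hb
  rw [lr, if_pos h]

lemma lr_size {l m nu : Partition'} (h : lr l m nu ≠ 0) : size nu = size l + size m := by
  by_contra h1
  exact h (by rw [lr, if_neg h1])

lemma kron_eq {l m nu : Partition'} {n : ℕ} (hl : size l = n) (hm : size m = n)
    (h : size nu = n) :
    kron l m nu = ((∑ g : Equiv.Perm (Fin n), irrChar n l g * irrChar n m g * irrChar n nu g) /
      (Nat.factorial n : ℤ)).toNat := by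
  subst h
  rw [kron, if_pos ⟨hl, hm⟩]

lemma kron_size {l m nu : Partition'} (h : kron l m nu ≠ 0) :
    size l = size nu ∧ size m = size nu := by
  by_contra h1
  exact h (by rw [kron, if_neg h1])

lemma fact_ne (n : ℕ) : (n.factorial : ℤ) ≠ 0 := by exact_mod_cast n.factorial_ne_zero

lemma lr_row {l m : Partition'} {a b : ℕ} (ha : size l = a) (hb : size m = b) :
    lr l m (row (a + b)) = if l = row a ∧ m = row b then 1 else 0 := by
  rw [lr_eq ha hb (size_row _)]
  simp only [irr_row, mul_one]
  rw [← Finset.sum_mul_sum, sum_irr ha, sum_irr hb]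
  by_cases h1 : l = row a <;> by_cases h2 : m = row b <;> simp [h1, h2]
  rw [Int.ediv_self (mul_ne_zero (fact_ne a) (fact_ne b))]
  rfl

lemma kron_row {nu : Partition'} {n : ℕ} (h : size nu = n) :
    kron (row n) (row n) nu = if nu = row n then 1 else 0 := by
  rw [kron_eq (size_row n) (size_row n) h]
  simp only [irr_row, one_mul]
  rw [sum_irr h]
  by_cases h1 : nu = row n <;> simp [h1]
  rw [Int.ediv_self (fact_ne n)]
  rfl

lemma lr_rows {t : Partition'} {a b : ℕ} (h : size t = a + b) :
    lr (row a) (row b) t = ((D (a + b) t).coeff a).toNat := by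
  rw [lr_eq (size_row a) (size_row b) h]
  simp only [irr_row, one_mul]
  have : ∑ g : Equiv.Perm (Fin a), ∑ h : Equiv.Perm (Fin b), irrChar (a + b) t (sumEmb g h) =
      ((Nat.factorial a : ℤ) * (Nat.factorial b : ℤ)) * (D (a + b) t).coeff a := by
    unfold irrChar
    simp_rw [D_coeff, Finset.mul_sum]
    conv_lhs =>
      enter [2, g]
      rw [Finset.sum_comm]
    rw [Finset.sum_comm]
    refine Finset.sum_congr rfl fun σ _ => ?_
    simp_rw [← Finset.mul_sum]
    rw [L3 _ (lc_sum h σ)]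
    ring
  rw [this, Int.mul_ediv_cancel_left _ (mul_ne_zero (fact_ne a) (fact_ne b))]

lemma inner_young {t : Partition'} {n a b : ℕ} (h : size t = n) (hab : a + b = n) (hn : 2 ≤ n) :
    ∑ g, irrChar n t g * youngCount n
      (fun i => if (i : ℕ) = 0 then (a : ℤ) else if (i : ℕ) = 1 then (b : ℤ) else 0) g =
      (n.factorial : ℤ) * (D n t).coeff a := by
  unfold irrChar
  simp_rw [D_coeff, Finset.mul_sum, Finset.sum_mul]
  rw [Finset.sum_comm]
  refine Finset.sum_congr rfl fun σ _ => ?_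
  simp_rw [mul_assoc]
  rw [← Finset.mul_sum, L4 hab hn _ (lc_sum h σ)]
  ring

lemma irr_dd {d : ℕ} (hd : 0 < d) (g : Equiv.Perm (Fin (2 * d))) :
    irrChar (2 * d) (twoRow d d le_rfl) g =
    youngCount (2 * d) (fun i => if (i : ℕ) = 0 then ((d : ℕ) : ℤ) else
      if (i : ℕ) = 1 then ((d : ℕ) : ℤ) else 0) g -
    youngCount (2 * d) (fun i => if (i : ℕ) = 0 then ((d + 1 : ℕ) : ℤ) else
      if (i : ℕ) = 1 then ((d - 1 : ℕ) : ℤ) else 0) g := by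
  have hv : ∀ i : ℕ, (twoRow d d le_rfl).1 i = if i = 0 then d else if i = 1 then d else 0 := by
    intro i
    simp only [twoRow, Finsupp.add_apply, Finsupp.single_apply]
    split_ifs <;> omega
  have := sum_two (n := 2 * d) (by omega) (fun σ => youngCount (2 * d)
    (fun i => ((twoRow d d le_rfl).1 i : ℤ) + ((σ i : ℕ) : ℤ) - (i : ℤ)) g) (by
      rintro σ ⟨i, hi, hi2⟩
      rw [youngCount, if_neg]
      intro h
      have := h i
      rw [hv, if_neg (by omega), if_neg (by omega)] at this
      push_cast at this
      omega)
  unfold irrChar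
  simp only [Int.cast_id] at this
  rw [this]
  congr 2
  · funext i
    rw [hv]
    simp only [Equiv.Perm.one_apply]
    split_ifs <;> simp
  · funext i
    rw [hv]
    split_ifs with h0 h1
    · have : i = ⟨0, by omega⟩ := Fin.ext h0
      rw [this, Equiv.swap_apply_left]
      simp
    · have : i = ⟨1, by omega⟩ := Fin.ext h1
      rw [this, Equiv.swap_apply_right]
      simp
      omega
    · rw [Equiv.swap_apply_of_ne_of_ne]
      · simp
      · simpa [Fin.ext_iff] using h0
      · simpa [Fin.ext_iff] using h1

lemma sumEmb_zero {a : ℕ} (g : Equiv.Perm (Fin a)) (h : Equiv.Perm (Fin 0)) :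
    (sumEmb g h : Equiv.Perm (Fin a)) = g := by
  apply Equiv.ext
  intro x
  exact sumEmb_castAdd g h x

lemma lr_dd {t : Partition'} {d : ℕ} (hd : 0 < d) (h : size t = 2 * d) :
    lr t (row 0) (twoRow d d le_rfl) =
      ((D (2 * d) t).coeff d - (D (2 * d) t).coeff (d + 1)).toNat := by
  rw [lr_eq h (size_row 0) (by rw [size_twoRow]; omega)]
  have : ∑ g : Equiv.Perm (Fin (2 * d)), ∑ h : Equiv.Perm (Fin 0),
        irrChar (2 * d) t g * irrChar 0 (row 0) h *
          irrChar (2 * d + 0) (twoRow d d le_rfl) (sumEmb g h) =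
      ((Nat.factorial (2 * d) : ℤ) * (Nat.factorial 0 : ℤ)) *
        ((D (2 * d) t).coeff d - (D (2 * d) t).coeff (d + 1)) := by
    simp only [irr_row, mul_one]
    have h1 : ∀ (g : Equiv.Perm (Fin (2 * d))) (h : Equiv.Perm (Fin 0)),
        irrChar (2 * d + 0) (twoRow d d le_rfl) (sumEmb g h) =
        irrChar (2 * d) (twoRow d d le_rfl) g := fun g h =>
      congrArg (irrChar (2 * d) (twoRow d d le_rfl)) (sumEmb_zero g h)
    simp_rw [h1, irr_dd hd]
    simp only [Finset.univ_unique, Finset.sum_singleton, mul_sub, Finset.sum_sub_distrib]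
    rw [inner_young h (by omega) (by omega), inner_young h (by omega) (by omega)]
    simp
  rw [this, Int.mul_ediv_cancel_left _ (mul_ne_zero (fact_ne _) (fact_ne _))]

lemma tau {t : Partition'} {d : ℕ} (hd : 0 < d) (h : size t = 2 * d) :
    lr (row d) (row d) t * lr t (row 0) (twoRow d d le_rfl) =
      if t = twoRow d d le_rfl then 1 else 0 := by
  have h' : size t = d + d := by omega
  rw [lr_rows h', lr_dd hd h, ← two_mul d]
  by_cases h2 : t.1 2 = 0
  · have hz : ∀ i, 2 ≤ i → t.1 i = 0 := fun i hi => by have := t.2 hi; omega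
    have hs := size_sum (2 * d) h le_rfl
    have h01 := t.2 (show 0 ≤ 1 by omega)
    have hpq : t.1 0 + t.1 1 = 2 * d := by
      rw [Fin.sum_univ_eq_sum_range (fun i => t.1 i),
        ← Finset.sum_subset (s₁ := Finset.range 2)] at hs
      · simpa [Finset.sum_range_succ] using hs
      · intro i hi
        simp at hi ⊢
        omega
      · intro i _ hi
        exact hz i (by rw [Finset.mem_range] at hi; omega)
    have ht : t = twoRow d d le_rfl ↔ t.1 0 = d := by
      constructor
      · rintro rfl
        simp [twoRow]
      · intro h0
        apply Subtype.ext
        ext i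
        simp only [twoRow, Finsupp.add_apply, Finsupp.single_apply]
        rcases i with _ | _ | i
        · simp [h0]
        · simp; omega
        · simp [hz]
    simp only [ht]
    rw [D_two (by omega) h2]
    simp only [finsetSum_coeff, coeff_X_pow, Finset.sum_ite_eq, Finset.mem_Ico]
    split_ifs <;> first | omega | simp
  · rw [D_zero h h2, if_neg]
    · simp
    · rintro rfl
      simp [twoRow] at h2

lemma term_eq {d : ℕ} (hd : 0 < d) (α β δ η ρ τ : Partition') :
    lr α β (row (2 * d)) * lr η ρ (row d) * kron β η δ * lr α δ τ * lr τ ρ (twoRow d d le_rfl) =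
    if α = row d ∧ β = row d ∧ δ = row d ∧ η = row d ∧ ρ = row 0 ∧ τ = twoRow d d le_rfl
      then 1 else 0 := by
  by_cases hsz : size α = d ∧ size β = d ∧ size δ = d ∧ size η = d ∧ size ρ = 0 ∧ size τ = 2 * d
  · obtain ⟨h1, h2, h3, h4, h5, h6⟩ := hsz
    have e1 := lr_row h1 h2
    rw [← two_mul] at e1
    have e2 := lr_row h4 h5
    rw [add_zero] at e2
    rw [e1, e2]
    by_cases ha : α = row d
    swap
    · simp [ha]
    by_cases hb : β = row d
    swap
    · simp [hb]
    by_cases he : η = row d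
    swap
    · simp [he]
    by_cases hr : ρ = row 0
    swap
    · simp [hr]
    subst ha hb he hr
    rw [kron_row h3]
    by_cases hdel : δ = row d
    swap
    · simp [hdel]
    subst hdel
    have := tau hd h6
    simp only [and_self, if_true, one_mul, true_and]
    exact this
  · rw [if_neg]
    · by_contra hne
      simp only [mul_eq_zero, not_or] at hne
      obtain ⟨⟨⟨⟨n1, n2⟩, n3⟩, n4⟩, n5⟩ := hne
      have a1 := lr_size n1
      have a2 := lr_size n2
      have a3 := kron_size n3
      have a4 := lr_size n4
      have a5 := lr_size n5
      rw [size_row] at a1 a2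
      rw [size_twoRow] at a5
      omega
    · rintro ⟨rfl, rfl, rfl, rfl, rfl, rfl⟩
      exact hsz ⟨size_row _, size_row _, size_row _, size_row _, size_row _, by
        rw [size_twoRow]; omega⟩

end AguiarAux

open Partition' in
/-- For every positive integer `d`, the Aguiar coefficient `a_{(2d),(d)}^{(d,d)}` equals 1. -/
theorem aguiar_two_one_oneOne_stable (d : ℕ) (hd : 0 < d) :
    aguiar (row (2 * d)) (row d) (twoRow d d le_rfl) = 1 := by
  unfold aguiar
  simp only [AguiarAux.term_eq hd]
  rw [finsum_eq_single _ (row d) (fun x hx => by simp [hx]),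
    finsum_eq_single _ (row d) (fun x hx => by simp [hx]),
    finsum_eq_single _ (row d) (fun x hx => by simp [hx]),
    finsum_eq_single _ (row d) (fun x hx => by simp [hx]),
    finsum_eq_single _ (row 0) (fun x hx => by simp [hx]),
    finsum_eq_single _ (twoRow d d le_rfl) (fun x hx => by simp [hx])]
  simp
end

section
/- If λ, μ, ν are three partitions all of the same size k, then the Aguiar coefficient a_{λ,μ}^ν equals the Kronecker coefficient g_{λ,μ,ν}. -/
open scoped BigOperators
open scoped Classical

section Aux
open Finset

theorem aux_prod_sub {R : Type*} [CommRing R] {ι : Type*} (s : Finset ι) (y : ι → R) (a b : R) :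
    ∏ k ∈ s, (a - b * y k) = ∑ m ∈ range (#s + 1), b ^ m * a ^ (#s - m) *
      ∑ t ∈ powersetCard m s, ∏ k ∈ t, (- y k) := by
  have h : ∀ k ∈ s, a - b * y k = b * (- y k) + a := fun k _ => by ring
  rw [prod_congr rfl h, prod_add, sum_powerset]
  refine sum_congr rfl fun m hm => ?_
  rw [mul_sum]
  refine sum_congr rfl fun t ht => ?_
  rw [mem_powersetCard] at ht
  rw [prod_mul_distrib, prod_const, prod_const, card_sdiff_of_subset ht.1, ht.2]
  ring

noncomputable def auxD {R : Type*} [CommRing R] {n : ℕ} (x : Fin n → R) : R :=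
  ∏ i : Fin n, ∏ j ∈ Ioi i, (x i - x j)

theorem auxD_eq_det {R : Type*} [CommRing R] {n : ℕ} (x : Fin n → R) :
    auxD x = (Matrix.projVandermonde 1 x).det := by
  rw [Matrix.det_projVandermonde]; simp [auxD]

theorem auxD_eq_sum {R : Type*} [CommRing R] {n : ℕ} (x : Fin n → R) :
    auxD x = ∑ σ : Equiv.Perm (Fin n), ((Equiv.Perm.sign σ : ℤ) : R) *
      ∏ i, x i ^ ((σ i).rev : ℕ) := by
  rw [auxD_eq_det, ← Matrix.det_transpose, Matrix.det_apply']
  simp [Matrix.projVandermonde_apply]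

theorem aux_prod_ne {R : Type*} [CommRing R] {n : ℕ} (y : Fin n → R) :
    ∏ i, ∏ k ∈ univ.erase i, (y i - y k) = auxD y * (Matrix.vandermonde y).det := by
  rw [Matrix.det_vandermonde]
  have h : ∀ i : Fin n, ∏ k ∈ univ.erase i, (y i - y k) =
      (∏ k ∈ Ioi i, (y i - y k)) * ∏ k ∈ Iio i, (y i - y k) := by
    intro i
    rw [← prod_union]
    · congr 1; ext k; simp; omega
    · rw [disjoint_left]; intro k; simp; omega
  simp_rw [h]
  rw [prod_mul_distrib]
  congr 1
  refine prod_comm' ?_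
  intro i j; simp

theorem aux_detM {R : Type*} [CommRing R] [IsDomain R] {n : ℕ} (x y : Fin n → R)
    (hy : Function.Injective y) :
    (Matrix.of fun i j => ∏ k ∈ univ.erase j, (1 - x i * y k)).det = auxD x * auxD y := by
  set c : Matrix (Fin n) (Fin n) R := Matrix.of fun m j =>
    ∑ t ∈ powersetCard (m : ℕ) (univ.erase j), ∏ k ∈ t, (- y k) with hc
  have key : ∀ (a b : R) (j : Fin n), ∏ k ∈ univ.erase j, (a - b * y k) =
      ∑ m : Fin n, b ^ (m : ℕ) * a ^ (m.rev : ℕ) * c m j := by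
    intro a b j
    have hcard : #(univ.erase j) + 1 = n := by
      rw [card_erase_of_mem (mem_univ _)]; simp; have := j.2; omega
    rw [aux_prod_sub, hcard, ← Fin.sum_univ_eq_sum_range (fun m => b ^ m * a ^ (#(univ.erase j) - m) *
      ∑ t ∈ powersetCard m (univ.erase j), ∏ k ∈ t, (- y k))]
    refine sum_congr rfl fun m _ => ?_
    have : #(univ.erase j) - (m : ℕ) = (m.rev : ℕ) := by rw [Fin.val_rev]; omega
    rw [this]; rfl
  have h1 : (Matrix.of fun i j => ∏ k ∈ univ.erase j, (1 - x i * y k)) =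
      Matrix.vandermonde x * c := by
    ext i j
    simp [Matrix.mul_apply, key, Matrix.vandermonde_apply]
  have h2 : Matrix.diagonal (fun i => ∏ k ∈ univ.erase i, (y i - y k)) =
      Matrix.projVandermonde 1 y * c := by
    ext i j
    rw [Matrix.mul_apply]
    have := key (y i) 1 j
    simp only [one_pow, one_mul] at this
    simp only [Matrix.projVandermonde_apply, Pi.one_apply, one_pow, one_mul]
    rw [← this]
    by_cases hij : i = j
    · subst hij; simp
    · rw [Matrix.diagonal_apply_ne _ hij, eq_comm]
      exact prod_eq_zero (i := i) (by simp [hij]) (by simp)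
  have h3 := congrArg Matrix.det h2
  rw [Matrix.det_diagonal, Matrix.det_mul, aux_prod_ne, ← auxD_eq_det] at h3
  have hne : auxD y ≠ 0 := by
    rw [auxD]
    refine prod_ne_zero_iff.2 fun i _ => prod_ne_zero_iff.2 fun j hj => ?_
    rw [sub_ne_zero]
    exact fun h => (mem_Ioi.1 hj).ne (hy h)
  have h4 := mul_left_cancel₀ hne h3
  rw [h1, Matrix.det_mul, ← h4, Matrix.det_vandermonde, Matrix.det_vandermonde, auxD, auxD,
    ← prod_mul_distrib, ← prod_mul_distrib]
  refine prod_congr rfl fun i _ => ?_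
  rw [← prod_mul_distrib, ← prod_mul_distrib]
  exact prod_congr rfl fun j _ => by ring

theorem aux_cauchy {R : Type*} [CommRing R] [IsDomain R] {n : ℕ} (x y : Fin n → R)
    (hy : Function.Injective y) (g : Fin n → Fin n → R) (hg : ∀ i j, g i j * (1 - x i * y j) = 1) :
    (Matrix.of g).det = auxD x * auxD y * ∏ i, ∏ j, g i j := by
  have : Matrix.of g = Matrix.of (fun i j => (∏ k, g i k) *
      (Matrix.of fun i j => ∏ k ∈ univ.erase j, (1 - x i * y k)) i j) := by
    ext i j
    simp only [Matrix.of_apply]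
    rw [← mul_prod_erase univ _ (mem_univ j), mul_assoc, ← prod_mul_distrib]
    simp [hg]
  rw [this, Matrix.det_mul_column, aux_detM x y hy]
  ring

noncomputable def auxGeo {A : Type*} [CommRing A] (w : A) : PowerSeries A :=
  PowerSeries.mk fun k => w ^ k

theorem auxGeo_mul {A : Type*} [CommRing A] (w : A) :
    auxGeo w * (1 - PowerSeries.X * PowerSeries.C w) = 1 := by
  ext k
  rw [mul_sub, mul_one, map_sub, ← mul_assoc, PowerSeries.coeff_mul_C]
  cases k with
  | zero => simp [auxGeo]
  | succ k => simp [auxGeo, PowerSeries.coeff_succ_mul_X, pow_succ, PowerSeries.coeff_one]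

theorem auxD_smul {A : Type*} [CommRing A] {n : ℕ} (x : Fin n → A) (t : A) :
    auxD (fun i => t * x i) = t ^ (∑ i : Fin n, (i.rev : ℕ)) * auxD x := by
  rw [auxD_eq_sum, auxD_eq_sum, mul_sum]
  refine sum_congr rfl fun σ _ => ?_
  have : ∑ i : Fin n, (i.rev : ℕ) = ∑ i : Fin n, ((σ i).rev : ℕ) :=
    (Equiv.sum_comp σ (fun i : Fin n => (i.rev : ℕ))).symm
  rw [this, ← prod_pow_eq_pow_sum]
  simp_rw [mul_pow, prod_mul_distrib]
  ring

theorem auxD_map {A B : Type*} [CommRing A] [CommRing B] (φ : A →+* B) {n : ℕ} (x : Fin n → A) :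
    auxD (fun i => φ (x i)) = φ (auxD x) := by
  simp [auxD, map_prod]

/-- Cauchy determinant, coefficientwise. -/
theorem aux_cauchy_coeff {A : Type*} [CommRing A] [IsDomain A] {n : ℕ} (x y : Fin n → A)
    (hy : Function.Injective y) (d : ℕ) :
    auxD x * auxD y * PowerSeries.coeff d (∏ c : Fin n × Fin n, auxGeo (x c.1 * y c.2)) =
    ∑ π : Equiv.Perm (Fin n), ((Equiv.Perm.sign π : ℤ) : A) *
      ∑ k ∈ finsuppAntidiag univ (d + ∑ i : Fin n, (i.rev : ℕ)),
        ∏ i, (x i * y (π i)) ^ (k i) := by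
  have h := aux_cauchy (R := PowerSeries A) (fun i => PowerSeries.X * PowerSeries.C (x i))
    (fun j => PowerSeries.C (y j)) (fun a b h => hy (PowerSeries.C_injective h))
    (fun i j => auxGeo (x i * y j)) (fun i j => by
      rw [mul_assoc, ← map_mul]; exact auxGeo_mul _)
  rw [auxD_smul, auxD_map, auxD_map, ← Matrix.det_transpose, Matrix.det_apply'] at h
  have h2 := congrArg (PowerSeries.coeff (d + ∑ i : Fin n, (i.rev : ℕ))) h
  rw [mul_assoc, mul_assoc, PowerSeries.coeff_X_pow_mul, PowerSeries.coeff_C_mul,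
    PowerSeries.coeff_C_mul] at h2
  rw [Fintype.prod_prod_type, mul_assoc, ← h2, map_sum]
  refine sum_congr rfl fun π _ => ?_
  have : (((Equiv.Perm.sign π : ℤ) : PowerSeries A)) =
    PowerSeries.C (((Equiv.Perm.sign π : ℤ) : A)) := by simp
  rw [this, PowerSeries.coeff_C_mul, PowerSeries.coeff_prod]
  simp [auxGeo]

end Aux

section Aux2
open Finset

noncomputable def auxCnt {n : ℕ} {α : Type*} [Fintype α] (F : Fin n → α) : α →₀ ℕ :=
  Finsupp.equivFunOnFinite.symm (fun c => #{p | F p = c})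

theorem auxCnt_apply {n : ℕ} {α : Type*} [Fintype α] (F : Fin n → α) (c : α) :
    auxCnt F c = #{p | F p = c} := rfl

theorem aux_prod_cnt {n : ℕ} {α A : Type*} [Fintype α] [CommRing A] (F : Fin n → α) (w : α → A) :
    ∏ p, w (F p) = ∏ c, w c ^ (auxCnt F c) := by
  rw [← prod_fiberwise' univ F w]
  refine prod_congr rfl fun c _ => ?_
  rw [prod_const, auxCnt_apply]

theorem auxCnt_sum {n : ℕ} {α : Type*} [Fintype α] (F : Fin n → α) : ∑ c, auxCnt F c = n := by
  have := card_eq_sum_card_fiberwise (s := (univ : Finset (Fin n))) (t := univ) (f := F) (by simp)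
  simpa [auxCnt_apply] using this.symm

theorem auxCnt_exists {n : ℕ} {α : Type*} [Fintype α] (k : α →₀ ℕ) (hk : ∑ c, k c = n) :
    ∃ F : Fin n → α, auxCnt F = k := by
  have e : Fin n ≃ Σ c, Fin (k c) := Fintype.equivOfCardEq (by simp [hk])
  refine ⟨fun p => (e p).1, ?_⟩
  ext c
  rw [auxCnt_apply, ← Fintype.card_subtype,
    Fintype.card_congr (e.subtypeEquiv (p := fun p => (e p).1 = c) (q := fun s => s.1 = c)
      (fun _ => Iff.rfl)), Fintype.card_congr (Equiv.sigmaSubtype c)]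
  simp

theorem auxCnt_perm {n : ℕ} {α : Type*} [Fintype α] (F G : Fin n → α) (h : auxCnt F = auxCnt G) :
    ∃ g : Equiv.Perm (Fin n), G ∘ g = F := by
  have e : ∀ c, {a // F a = c} ≃ {b // G b = c} := fun c => Fintype.equivOfCardEq (by
    rw [Fintype.card_subtype, Fintype.card_subtype, ← auxCnt_apply, ← auxCnt_apply, h])
  exact ⟨Equiv.ofFiberEquiv e, funext fun a => Equiv.ofFiberEquiv_map e a⟩

theorem auxCnt_comp {n : ℕ} {α : Type*} [Fintype α] (F : Fin n → α) (g : Equiv.Perm (Fin n)) :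
    auxCnt (F ∘ g) = auxCnt F := by
  ext c
  rw [auxCnt_apply, auxCnt_apply, ← Fintype.card_subtype, ← Fintype.card_subtype]
  exact Fintype.card_congr (g.subtypeEquiv (fun _ => Iff.rfl))

theorem aux_orbit {n : ℕ} {α : Type*} [Fintype α] (k : α →₀ ℕ) (hk : ∑ c, k c = n) :
    ∑ F : Fin n → α with auxCnt F = k, #{g : Equiv.Perm (Fin n) | F ∘ g = F} = n.factorial := by
  obtain ⟨F0, rfl⟩ := auxCnt_exists k hk
  have h := card_eq_sum_card_fiberwise (s := (univ : Finset (Equiv.Perm (Fin n))))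
    (t := {F : Fin n → α | auxCnt F = auxCnt F0}) (f := fun g : Equiv.Perm (Fin n) => F0 ∘ g)
    (fun g _ => by simp [auxCnt_comp])
  rw [card_univ, Fintype.card_perm, Fintype.card_fin] at h
  rw [h]
  refine sum_congr rfl fun F hF => ?_
  obtain ⟨u, hu⟩ := auxCnt_perm F F0 (by simpa using hF)
  refine card_bij (fun g _ => u * g) ?_ ?_ ?_
  · intro g hg
    simp only [mem_filter, mem_univ, true_and] at hg ⊢
    rw [Equiv.Perm.coe_mul, ← Function.comp_assoc, hu, hg]
  · intro a _ b _ hab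
    exact mul_left_cancel hab
  · intro g hg
    simp only [mem_filter, mem_univ, true_and] at hg ⊢
    refine ⟨u⁻¹ * g, ?_, by simp⟩
    rw [← hu, Function.comp_assoc, ← Equiv.Perm.coe_mul, mul_inv_cancel_left, hg, hu]

theorem aux_burnside {n : ℕ} {α A : Type*} [Fintype α] [CommRing A] (w : α → A) :
    ∑ g : Equiv.Perm (Fin n), ∑ F : Fin n → α with F ∘ g = F, ∏ p, w (F p) =
      (n.factorial : A) * PowerSeries.coeff n (∏ c, auxGeo (w c)) := by
  simp_rw [sum_filter]
  rw [sum_comm]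
  simp_rw [← sum_filter, sum_const]
  rw [PowerSeries.coeff_prod, mul_sum]
  rw [← sum_fiberwise_of_maps_to (s := univ) (t := finsuppAntidiag univ n) (g := auxCnt)
    (fun F _ => by simp [auxCnt_sum])]
  refine sum_congr rfl fun k hk => ?_
  have hk' : ∑ c, k c = n := by simpa using hk
  rw [← aux_orbit k hk', Nat.cast_sum, sum_mul]
  refine sum_congr rfl fun F hF => ?_
  have hF' : auxCnt F = k := by simpa using hF
  rw [aux_prod_cnt, hF', nsmul_eq_mul]
  simp [auxGeo]

end Aux2

namespace Partition'
open Finset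

theorem aux_monomial {S : Type*} [CommRing S] {n : ℕ} (e : Fin n →₀ ℕ) :
    ∏ i, (MvPolynomial.X i : MvPolynomial (Fin n) S) ^ (e i) = MvPolynomial.monomial e 1 := by
  rw [MvPolynomial.monomial_eq, Finsupp.prod_fintype _ _ (by simp)]
  simp

noncomputable def auxY {n : ℕ} (g : Equiv.Perm (Fin n)) : MvPolynomial (Fin n) ℤ :=
  ∑ f : Fin n → Fin n with f ∘ g = f, ∏ p, MvPolynomial.X (f p)

theorem auxY_coeff {n : ℕ} (g : Equiv.Perm (Fin n)) (a : Fin n →₀ ℕ) :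
    MvPolynomial.coeff a (auxY g) = youngCount n (fun i => (a i : ℤ)) g := by
  rw [youngCount, if_pos (fun i => by positivity), auxY, MvPolynomial.coeff_sum]
  simp_rw [aux_prod_cnt, aux_monomial, MvPolynomial.coeff_monomial]
  rw [sum_boole, filter_filter, Nat.card_eq_fintype_card, Fintype.card_subtype]
  congr 2
  ext f
  simp only [mem_filter, mem_univ, true_and, Int.toNat_natCast]
  refine and_congr_right fun _ => ?_
  rw [Finsupp.ext_iff]
  refine forall_congr' fun i => ?_
  rw [auxCnt_apply, Nat.card_eq_fintype_card, Fintype.card_subtype]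
  exact Eq.congr_left (by congr!)

noncomputable def auxExp (n : ℕ) (l : Partition') : Fin n →₀ ℕ :=
  Finsupp.equivFunOnFinite.symm fun i => l.1 i + (i.rev : ℕ)

theorem auxExp_apply (n : ℕ) (l : Partition') (i : Fin n) :
    auxExp n l i = l.1 i + (i.rev : ℕ) := rfl

theorem irrChar_eq_coeff (n : ℕ) (l : Partition') (g : Equiv.Perm (Fin n)) :
    irrChar n l g = MvPolynomial.coeff (auxExp n l)
      (auxD (fun i => (MvPolynomial.X i : MvPolynomial (Fin n) ℤ)) * auxY g) := by
  rw [irrChar, auxD_eq_sum, sum_mul, MvPolynomial.coeff_sum]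
  refine sum_congr rfl fun σ _ => ?_
  have h1 : ∏ i, (MvPolynomial.X i : MvPolynomial (Fin n) ℤ) ^ ((σ i).rev : ℕ) =
      MvPolynomial.monomial (Finsupp.equivFunOnFinite.symm fun i => ((σ i).rev : ℕ)) 1 := by
    rw [← aux_monomial]; rfl
  have h2 : (((Equiv.Perm.sign σ : ℤ) : MvPolynomial (Fin n) ℤ)) =
    MvPolynomial.C ((Equiv.Perm.sign σ : ℤ)) := by simp
  rw [h1, h2, mul_assoc, MvPolynomial.coeff_C_mul, MvPolynomial.coeff_monomial_mul']
  congr 1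
  split_ifs with hle
  · rw [one_mul, auxY_coeff]
    congr 1
    funext i
    have := hle i
    rw [Finsupp.coe_tsub, Pi.sub_apply]
    simp only [auxExp_apply, Finsupp.equivFunOnFinite_symm_apply_apply, Fin.val_rev] at this ⊢
    have := i.2
    have := (σ i).2
    omega
  · rw [youngCount, if_neg]
    intro hall
    apply hle
    intro i
    have := hall i
    simp only [auxExp_apply, Finsupp.equivFunOnFinite_symm_apply_apply, Fin.val_rev]
    have := i.2
    have := (σ i).2
    omega

theorem size_eq_sum (n : ℕ) (l : Partition') (hl : size l = n) :
    (∀ i, n ≤ i → l.1 i = 0) ∧ ∑ i : Fin n, l.1 i = n := by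
  have h0 : ∀ i, n ≤ i → l.1 i = 0 := by
    intro i hi
    by_contra hne
    have hsub : range (n + 1) ⊆ l.1.support := by
      intro j hj
      rw [mem_range] at hj
      have := l.2 (show j ≤ i by omega)
      rw [Finsupp.mem_support_iff]
      omega
    have h1 : ∑ j ∈ range (n + 1), 1 ≤ size l := by
      rw [size, Finsupp.sum]
      calc ∑ j ∈ range (n + 1), 1 ≤ ∑ j ∈ l.1.support, 1 :=
            sum_le_sum_of_subset hsub
        _ ≤ _ := sum_le_sum fun j hj => by
            have := Finsupp.mem_support_iff.1 hj; omega
    simp at h1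
    omega
  refine ⟨h0, ?_⟩
  rw [Fin.sum_univ_eq_sum_range (fun i => l.1 i), ← hl, size, Finsupp.sum]
  symm
  apply sum_subset
  · intro i hi
    rw [mem_range]
    change i < size l
    rw [hl]
    by_contra hlt
    exact Finsupp.mem_support_iff.1 hi (h0 i (by omega))
  · intro i _ hi
    simpa using hi

theorem auxExp_strictAnti (n : ℕ) (l : Partition') : StrictAnti (auxExp n l) := by
  intro i j hij
  rw [auxExp_apply, auxExp_apply]
  have := l.2 (show (i : ℕ) ≤ j from hij.le)
  have h : (i : ℕ) < j := hij
  have := j.2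
  simp only [Fin.val_rev]
  omega

theorem auxExp_inj (n : ℕ) (l m : Partition') (hl : size l = n) (hm : size m = n)
    (h : auxExp n l = auxExp n m) : l = m := by
  apply Subtype.ext
  ext i
  by_cases hi : i < n
  · have := DFunLike.congr_fun h ⟨i, hi⟩
    rw [auxExp_apply, auxExp_apply] at this
    simpa using this
  · rw [(size_eq_sum n l hl).1 i (by omega), (size_eq_sum n m hm).1 i (by omega)]

theorem aux_perm_one (n : ℕ) (a b : Fin n →₀ ℕ) (ha : StrictAnti a) (hb : StrictAnti b)
    (π : Equiv.Perm (Fin n)) (h : ∀ i, b (π i) = a i) : π = 1 := by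
  have hm : StrictMono π := by
    intro i j hij
    have h1 := ha hij
    rw [← h, ← h] at h1
    exact hb.lt_iff_gt.1 h1
  ext i
  have := Subsingleton.elim (hm.orderIsoOfSurjective π π.surjective) (OrderIso.refl _)
  have := DFunLike.congr_fun this i
  simpa using congrArg Fin.val this

set_option maxHeartbeats 1000000 in
theorem irrChar_orthonormal (n : ℕ) (l m : Partition') (hl : size l = n) (hm : size m = n) :
    ∑ g : Equiv.Perm (Fin n), irrChar n l g * irrChar n m g =
      if l = m then (n.factorial : ℤ) else 0 := by
  set a := auxExp n l with ha
  set b := auxExp n m with hb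
  let x : Fin n → MvPolynomial (Fin n) (MvPolynomial (Fin n) ℤ) := fun i => MvPolynomial.X i
  let y : Fin n → MvPolynomial (Fin n) (MvPolynomial (Fin n) ℤ) := fun i => MvPolynomial.C (MvPolynomial.X i)
  have hy : Function.Injective y := fun i j h =>
    MvPolynomial.X_injective (MvPolynomial.C_injective _ _ h)
  let φ : (MvPolynomial (Fin n) ℤ) →+* MvPolynomial (Fin n) (MvPolynomial (Fin n) ℤ) := MvPolynomial.map MvPolynomial.C
  have step1 : ∀ p q : (MvPolynomial (Fin n) ℤ), MvPolynomial.coeff a p * MvPolynomial.coeff b q =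
      MvPolynomial.coeff b (MvPolynomial.coeff a (φ p * MvPolynomial.C q)) := by
    intro p q
    rw [mul_comm (φ p), MvPolynomial.coeff_C_mul, MvPolynomial.coeff_map, mul_comm q,
      MvPolynomial.coeff_C_mul]
  have step2 : ∑ g : Equiv.Perm (Fin n), φ (auxY g) * MvPolynomial.C (auxY g) =
      ((n.factorial : ℕ) : MvPolynomial (Fin n) (MvPolynomial (Fin n) ℤ)) *
        PowerSeries.coeff n (∏ c : Fin n × Fin n, auxGeo (x c.1 * y c.2)) := by
    rw [← aux_burnside]
    refine sum_congr rfl fun g _ => ?_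
    simp only [auxY, map_sum, map_prod]
    rw [sum_mul_sum, ← sum_product']
    refine sum_bij (fun q _ => fun p => (q.1 p, q.2 p)) ?_ ?_ ?_ ?_
    · intro q hq
      simp only [mem_product, mem_filter, mem_univ, true_and] at hq ⊢
      funext p
      exact Prod.ext (congrFun hq.1 p) (congrFun hq.2 p)
    · intro q _ q' _ h
      exact Prod.ext (funext fun p => congrArg Prod.fst (congrFun h p))
        (funext fun p => congrArg Prod.snd (congrFun h p))
    · intro F hF
      simp only [mem_filter, mem_univ, true_and] at hF
      refine ⟨(fun p => (F p).1, fun p => (F p).2), ?_, rfl⟩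
      simp only [mem_product, mem_filter, mem_univ, true_and]
      exact ⟨funext fun p => congrArg Prod.fst (congrFun hF p),
        funext fun p => congrArg Prod.snd (congrFun hF p)⟩
    · intro q _
      rw [← prod_mul_distrib]
      refine prod_congr rfl fun p _ => ?_
      simp [φ, x, y]
  have hDx : φ (auxD fun i => MvPolynomial.X i) = auxD x := by
    rw [← auxD_map]; congr 1; funext i; simp [φ, x]
  have hDy : (MvPolynomial.C (auxD fun i => (MvPolynomial.X i : (MvPolynomial (Fin n) ℤ))) : MvPolynomial (Fin n) (MvPolynomial (Fin n) ℤ))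
      = auxD y := by
    rw [← auxD_map]
  have hsum : ∑ i, a i = n + ∑ i : Fin n, (i.rev : ℕ) := by
    simp_rw [ha, auxExp_apply]
    rw [sum_add_distrib, (size_eq_sum n l hl).2]
  have step3 : ∀ (π : Equiv.Perm (Fin n)) (k : Fin n →₀ ℕ),
      MvPolynomial.coeff b (MvPolynomial.coeff a (∏ i, (x i * y (π i)) ^ (k i))) =
        if k = a ∧ (∀ i, b (π i) = k i) then (1 : ℤ) else 0 := by
    intro π k
    have e1 : ∏ i, (x i * y (π i)) ^ (k i) =
        MvPolynomial.monomial k 1 *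
          MvPolynomial.C (MvPolynomial.monomial (Finsupp.equivMapDomain π k) 1 : (MvPolynomial (Fin n) ℤ)) := by
      simp_rw [mul_pow, prod_mul_distrib]
      rw [aux_monomial, ← aux_monomial (Finsupp.equivMapDomain π k), map_prod]
      congr 1
      rw [← Equiv.prod_comp π (fun i => (MvPolynomial.C (MvPolynomial.X i ^
        (Finsupp.equivMapDomain π k) i) : MvPolynomial (Fin n) (MvPolynomial (Fin n) ℤ)))]
      refine prod_congr rfl fun i _ => ?_
      simp [y, Finsupp.equivMapDomain_apply]
    rw [e1, mul_comm, MvPolynomial.coeff_C_mul, MvPolynomial.coeff_monomial]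
    by_cases hka : k = a
    · rw [if_pos hka, mul_one, MvPolynomial.coeff_monomial]
      refine if_congr ?_ rfl rfl
      rw [and_iff_right hka]
      constructor
      · rintro h i
        rw [← h]; simp [Finsupp.equivMapDomain_apply]
      · intro h
        ext i
        rw [Finsupp.equivMapDomain_apply, ← h]; simp
    · rw [if_neg hka, mul_zero, if_neg (fun h => hka h.1)]; simp
  have main : ∑ g : Equiv.Perm (Fin n), irrChar n l g * irrChar n m g =
      (n.factorial : ℤ) * MvPolynomial.coeff b (MvPolynomial.coeff a (auxD x * auxD y *
        PowerSeries.coeff n (∏ c : Fin n × Fin n, auxGeo (x c.1 * y c.2)))) := by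
    have e : ∀ q : MvPolynomial (Fin n) (MvPolynomial (Fin n) ℤ), (n.factorial : ℤ) *
        MvPolynomial.coeff b (MvPolynomial.coeff a q) =
        MvPolynomial.coeff b (MvPolynomial.coeff a (((n.factorial : ℕ) :
          MvPolynomial (Fin n) (MvPolynomial (Fin n) ℤ)) * q)) := by
      intro q
      simp only [← nsmul_eq_mul]
      rw [MvPolynomial.coeff_smul, MvPolynomial.coeff_smul]
    rw [e, mul_left_comm, ← step2, mul_sum, MvPolynomial.coeff_sum, MvPolynomial.coeff_sum]
    refine sum_congr rfl fun g _ => ?_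
    rw [irrChar_eq_coeff, irrChar_eq_coeff, step1, map_mul, map_mul, hDx, hDy,
      mul_mul_mul_comm]
  rw [main, aux_cauchy_coeff x y hy, MvPolynomial.coeff_sum, MvPolynomial.coeff_sum]
  have step4 : ∀ π : Equiv.Perm (Fin n), MvPolynomial.coeff b (MvPolynomial.coeff a
      (((Equiv.Perm.sign π : ℤ) : MvPolynomial (Fin n) (MvPolynomial (Fin n) ℤ)) *
      ∑ k ∈ finsuppAntidiag univ (n + ∑ i : Fin n, (i.rev : ℕ)),
        ∏ i, (x i * y (π i)) ^ (k i))) =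
      if π = 1 ∧ l = m then 1 else 0 := by
    intro π
    rw [← zsmul_eq_mul, MvPolynomial.coeff_smul, MvPolynomial.coeff_smul,
      MvPolynomial.coeff_sum, MvPolynomial.coeff_sum]
    simp_rw [step3]
    rw [sum_eq_single_of_mem a (by simp [hsum]) (fun k _ hk => if_neg (fun h => hk h.1))]
    by_cases h : ∀ i, b (π i) = a i
    · have hπ := aux_perm_one n a b (auxExp_strictAnti n l) (auxExp_strictAnti n m) π h
      subst hπ
      have hlm : l = m := auxExp_inj n l m hl hm (Finsupp.ext fun i => (h i).symm)
      rw [if_pos ⟨rfl, h⟩, if_pos ⟨rfl, hlm⟩]; simp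
    · rw [if_neg (fun h' => h h'.2), if_neg]
      · simp
      · rintro ⟨rfl, rfl⟩
        exact h fun i => rfl
  rw [sum_congr rfl fun π _ => step4 π]
  by_cases hlm : l = m <;> simp [hlm]

theorem youngCount_conj (n : ℕ) (a : Fin n → ℤ) (g u : Equiv.Perm (Fin n)) :
    youngCount n a (u.permCongr g) = youngCount n a g := by
  rw [youngCount, youngCount]
  split_ifs
  · congr 1
    refine Nat.card_congr ((u.symm.arrowCongr (Equiv.refl _)).subtypeEquiv ?_)
    intro f
    have hf : (u.symm.arrowCongr (Equiv.refl (Fin n))) f = f ∘ u := by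
      funext p; simp [Equiv.arrowCongr]
    rw [hf]
    refine and_congr ?_ (forall_congr' fun i => ?_)
    · constructor
      · intro h
        funext p
        have := congrFun h (u p)
        simpa [Equiv.permCongr_apply] using this
      · intro h
        funext p
        have := congrFun h (u.symm p)
        simpa [Equiv.permCongr_apply] using this
    · rw [Nat.card_congr (u.subtypeEquiv (p := fun p => (f ∘ u) p = i) (q := fun p => f p = i)
        (fun _ => Iff.rfl))]
  · rfl

theorem irrChar_equiv {a b : ℕ} (e : Fin a ≃ Fin b) (l : Partition') (g : Equiv.Perm (Fin a)) :
    irrChar b l (e.permCongr g) = irrChar a l g := by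
  have hab : a = b := by simpa using Fintype.card_congr e
  subst hab
  simp only [irrChar, youngCount_conj]

theorem irrChar_zero (l : Partition') (g : Equiv.Perm (Fin 0)) : irrChar 0 l g = 1 := by
  have : ∀ f : Fin 0 → Fin 0, f ∘ g = f := fun f => Subsingleton.elim _ _
  simp [irrChar, youngCount, this]

theorem lr_size (l m nu : Partition') (h : lr l m nu ≠ 0) : size nu = size l + size m := by
  by_contra h'
  exact h (if_neg h')

theorem kron_size (l m nu : Partition') (h : kron l m nu ≠ 0) :
    size l = size nu ∧ size m = size nu := by
  by_contra h'
  exact h (if_neg h')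

theorem irrChar_sumEmb_left {b : ℕ} (nu : Partition') (g : Equiv.Perm (Fin 0))
    (h : Equiv.Perm (Fin b)) : irrChar (0 + b) nu (sumEmb g h) = irrChar b nu h := by
  rw [← irrChar_equiv ((Equiv.emptySum (Fin 0) (Fin b)).symm.trans finSumFinEquiv) nu h]
  congr 1
  ext p
  obtain ⟨q, rfl⟩ := finSumFinEquiv.surjective p
  rcases q with q | q
  · exact q.elim0
  · simp only [sumEmb, Equiv.permCongr_apply, Equiv.symm_trans_apply, Equiv.trans_apply,
      Equiv.symm_apply_apply, Equiv.symm_symm]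
    rfl

theorem irrChar_sumEmb_right {b : ℕ} (nu : Partition') (h : Equiv.Perm (Fin b))
    (g : Equiv.Perm (Fin 0)) : irrChar (b + 0) nu (sumEmb h g) = irrChar b nu h := by
  rw [← irrChar_equiv ((Equiv.sumEmpty (Fin b) (Fin 0)).symm.trans finSumFinEquiv) nu h]
  congr 1
  ext p
  obtain ⟨q, rfl⟩ := finSumFinEquiv.surjective p
  rcases q with q | q
  · simp only [sumEmb, Equiv.permCongr_apply, Equiv.symm_trans_apply, Equiv.trans_apply,
      Equiv.symm_apply_apply, Equiv.symm_symm]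
    rfl
  · exact q.elim0

theorem lr_zero_left (z l m : Partition') (hz : size z = 0) :
    lr z l m = if l = m then 1 else 0 := by
  rw [lr]
  split_ifs with h1 h2 h2
  · subst h2
    rw [hz]
    simp only [irrChar_sumEmb_left, irrChar_zero, one_mul]
    rw [Fintype.sum_unique, irrChar_orthonormal _ l l rfl rfl, if_pos rfl]
    have : ((size l).factorial : ℤ) ≠ 0 := by positivity
    simp [Int.ediv_self this]
  · rw [hz]
    simp only [irrChar_sumEmb_left, irrChar_zero, one_mul]
    rw [Fintype.sum_unique, irrChar_orthonormal _ l m rfl (by omega), if_neg h2]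
    simp
  · subst h2; omega
  · rfl

theorem lr_zero_right (z l m : Partition') (hz : size z = 0) :
    lr l z m = if l = m then 1 else 0 := by
  rw [lr]
  split_ifs with h1 h2 h2
  · subst h2
    rw [hz]
    simp only [irrChar_sumEmb_right, irrChar_zero, mul_one]
    simp_rw [Fintype.sum_unique]
    rw [irrChar_orthonormal _ l l rfl rfl, if_pos rfl]
    have : ((size l).factorial : ℤ) ≠ 0 := by positivity
    simp [Int.ediv_self this]
  · rw [hz]
    simp only [irrChar_sumEmb_right, irrChar_zero, mul_one]
    simp_rw [Fintype.sum_unique]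
    rw [irrChar_orthonormal _ l m rfl (by omega), if_neg h2]
    simp
  · subst h2; omega
  · rfl

theorem size_row_zero : size (row 0) = 0 := by simp [size, row]

theorem eq_row_zero (l : Partition') (h : size l = 0) : l = row 0 := by
  apply Subtype.ext
  ext i
  rw [(size_eq_sum 0 l h).1 i (by omega)]
  simp [row]

theorem aguiar_term_ne_zero (l m nu : Partition') (k : ℕ)
    (hl : size l = k) (hm : size m = k) (hnu : size nu = k) (α β δ η ρ τ : Partition')
    (h : lr α β l * lr η ρ m * kron β η δ * lr α δ τ * lr τ ρ nu ≠ 0) :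
    α = row 0 ∧ β = l ∧ δ = nu ∧ η = m ∧ ρ = row 0 ∧ τ = nu := by
  simp only [mul_ne_zero_iff] at h
  obtain ⟨⟨⟨⟨h1, h2⟩, h3⟩, h4⟩, h5⟩ := h
  have e1 := lr_size _ _ _ h1
  have e2 := lr_size _ _ _ h2
  have e3 := kron_size _ _ _ h3
  have e4 := lr_size _ _ _ h4
  have e5 := lr_size _ _ _ h5
  have hα : size α = 0 := by omega
  have hρ : size ρ = 0 := by omega
  rw [lr_zero_left _ _ _ hα] at h1 h4
  rw [lr_zero_right _ _ _ hρ] at h2 h5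
  have q1 : β = l := by by_contra hh; exact h1 (if_neg hh)
  have q2 : η = m := by by_contra hh; exact h2 (if_neg hh)
  have q4 : δ = τ := by by_contra hh; exact h4 (if_neg hh)
  have q5 : τ = nu := by by_contra hh; exact h5 (if_neg hh)
  exact ⟨eq_row_zero _ hα, q1, q4.trans q5, q2, eq_row_zero _ hρ, q5⟩

end Partition'

open Partition' in
/-- If `λ, μ, ν` all have the same size `k`, then the Aguiar coefficient `a_{λ,μ}^ν`
equals the Kronecker coefficient `g_{λ,μ,ν}`. -/
theorem aguiar_eq_kron_of_equal_sizes (l m nu : Partition') (k : ℕ)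
    (hl : size l = k) (hm : size m = k) (hnu : size nu = k) :
    aguiar l m nu = kron l m nu := by
  have key := aguiar_term_ne_zero l m nu k hl hm hnu
  have z : ∀ α β δ η ρ τ : Partition',
      ¬ (α = row 0 ∧ β = l ∧ δ = nu ∧ η = m ∧ ρ = row 0 ∧ τ = nu) →
      lr α β l * lr η ρ m * kron β η δ * lr α δ τ * lr τ ρ nu = 0 := by
    intro α β δ η ρ τ h
    by_contra h'
    exact h (key _ _ _ _ _ _ h')
  rw [aguiar]
  rw [finsum_eq_single _ (row 0)]
  · rw [finsum_eq_single _ l]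
    · rw [finsum_eq_single _ nu]
      · rw [finsum_eq_single _ m]
        · rw [finsum_eq_single _ (row 0)]
          · rw [finsum_eq_single _ nu]
            · simp [lr_zero_left _ _ _ size_row_zero, lr_zero_right _ _ _ size_row_zero]
            · intro τ h; exact z _ _ _ _ _ _ (by tauto)
          · intro ρ h
            simp only [z _ _ _ _ ρ _ (fun hh => h hh.2.2.2.2.1), finsum_zero]
        · intro η h
          simp only [z _ _ _ η _ _ (fun hh => h hh.2.2.2.1), finsum_zero]
      · intro δ h
        simp only [z _ _ δ _ _ _ (fun hh => h hh.2.2.1), finsum_zero]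
    · intro β h
      simp only [z _ β _ _ _ _ (fun hh => h hh.2.1), finsum_zero]
  · intro α h
    simp only [z α _ _ _ _ _ (fun hh => h hh.1), finsum_zero]
end
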